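/- The Gromov-Hausdorff-Prokhorov distance d induces a metric on the set ℳ̂_* of GHP-isometry classes of boundedly compact pmm spaces: d depends only on GHP-isometry classes, is symmetric, satisfies the triangle inequality d(𝒳,𝒵) ≤ d(𝒳,𝒴) + d(𝒴,𝒵), and d(𝒳,𝒴) = 0 if and only if 𝒳 and 𝒴 are GHP-isometric. -/

import Mathlib

open MeasureTheory Topology Filter

noncomputable section

/-- Prokhorov distance between finite Borel measures on a metric space. -/
def prokhorovDist {Z : Type*} [MetricSpace Z] [MeasurableSpace Z]
    (μ ν : Measure Z) : ℝ :=
  sInf {ε : ℝ | 0 < ε ∧ ∀ A : Set Z, IsClosed A →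
    μ A ≤ ν (Metric.cthickening ε A) + ENNReal.ofReal ε ∧
    ν A ≤ μ (Metric.cthickening ε A) + ENNReal.ofReal ε}

/-- A pointed measured metric space: a metric space with a distinguished point and a Borel
measure. -/
structure PMM : Type 1 where
  carrier : Type
  metric : MetricSpace carrier
  basepoint : carrier
  meas : @Measure carrier
    (@borel carrier metric.toPseudoMetricSpace.toUniformSpace.toTopologicalSpace)

attribute [instance] PMM.metric

instance PMM.instMeasurableSpace (𝒳 : PMM) : MeasurableSpace 𝒳.carrier := borel 𝒳.carrier

instance PMM.instBorelSpace (𝒳 : PMM) : BorelSpace 𝒳.carrier := ⟨rfl⟩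

/-- A pmm space is boundedly compact if every closed ball is compact and has finite measure. -/
def PMM.BoundedlyCompact (𝒳 : PMM) : Prop :=
  (∀ (x : 𝒳.carrier) (r : ℝ), IsCompact (Metric.closedBall x r)) ∧
  (∀ (x : 𝒳.carrier) (r : ℝ), 𝒳.meas (Metric.closedBall x r) ≠ ⊤)

/-- A pmm space is compact if its carrier is compact and its measure is finite. -/
def PMM.IsCompactPMM (𝒳 : PMM) : Prop :=
  CompactSpace 𝒳.carrier ∧ 𝒳.meas Set.univ ≠ ⊤

/-- A pair of maps of two pmm spaces into a common metric space. -/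
structure GHPEmbedding (𝒳 𝒴 : PMM) : Type 1 where
  Z : Type
  mZ : MetricSpace Z
  f : 𝒳.carrier → Z
  g : 𝒴.carrier → Z

attribute [instance] GHPEmbedding.mZ

/-- Both maps of a `GHPEmbedding` are isometric embeddings. -/
def GHPEmbedding.IsIsometric {𝒳 𝒴 : PMM} (e : GHPEmbedding 𝒳 𝒴) : Prop :=
  Isometry e.f ∧ Isometry e.g

/-- The quantity `max(d(f o_X, g o_Y), dH(f(X), g(Y)), dP(f_*μ_X, g_*μ_Y))` associated to a
pair of embeddings into a common space. -/
def GHPEmbedding.value {𝒳 𝒴 : PMM} (e : GHPEmbedding 𝒳 𝒴) : ℝ :=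
  letI : MeasurableSpace e.Z := borel e.Z
  max (dist (e.f 𝒳.basepoint) (e.g 𝒴.basepoint))
    (max (Metric.hausdorffDist (Set.range e.f) (Set.range e.g))
      (prokhorovDist (𝒳.meas.map e.f) (𝒴.meas.map e.g)))

/-- The Gromov-Hausdorff-Prokhorov distance of compact pmm spaces. -/
def cGHP (𝒳 𝒴 : PMM) : ℝ :=
  sInf {x : ℝ | ∃ e : GHPEmbedding 𝒳 𝒴, e.IsIsometric ∧ x = e.value}

/-- A pmm-subspace of a pmm space `𝒳`: a subset containing the basepoint together with a
measure `≤ 𝒳.meas` supported on the subset. -/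
structure SubPMM (𝒳 : PMM) where
  set : Set 𝒳.carrier
  root_mem : 𝒳.basepoint ∈ set
  meas : Measure 𝒳.carrier
  meas_le : meas ≤ 𝒳.meas
  supported : meas setᶜ = 0

/-- The pmm space associated to a pmm-subspace. -/
def SubPMM.toPMM {𝒳 : PMM} (S : SubPMM 𝒳) : PMM where
  carrier := ↥S.set
  metric := inferInstance
  basepoint := ⟨𝒳.basepoint, S.root_mem⟩
  meas := @Measure.comap ↥S.set 𝒳.carrier (borel ↥S.set) inferInstance Subtype.val S.meas

/-- The pmm-subspace ordering: inclusion of sets and inequality of measures. -/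
instance {𝒳 : PMM} : LE (SubPMM 𝒳) :=
  ⟨fun S T => S.set ⊆ T.set ∧ S.meas ≤ T.meas⟩

/-- Compactness of a pmm-subspace. -/
def SubPMM.IsCompactSub {𝒳 : PMM} (S : SubPMM 𝒳) : Prop :=
  IsCompact S.set ∧ S.meas Set.univ ≠ ⊤

/-- The closed ball of radius `r` around the basepoint, as a pmm-subspace (for `r ≥ 0` the
underlying set is exactly the closed ball; the basepoint is inserted so that the definition
makes sense for all `r`). -/
def PMM.ballSub (𝒳 : PMM) (r : ℝ) : SubPMM 𝒳 where
  set := insert 𝒳.basepoint (Metric.closedBall 𝒳.basepoint r)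
  root_mem := Set.mem_insert _ _
  meas := 𝒳.meas.restrict (insert 𝒳.basepoint (Metric.closedBall 𝒳.basepoint r))
  meas_le := Measure.restrict_le_self
  supported := by
    rw [Measure.restrict_apply ((measurableSet_closedBall.insert 𝒳.basepoint).compl),
      Set.compl_inter_self]
    simp

/-- The quantity `a(ε, r; 𝒳, 𝒴)`. -/
def aFun (ε r : ℝ) (𝒳 𝒴 : PMM) : ℝ :=
  sInf {x : ℝ | ∃ Y' : SubPMM 𝒴, Y'.IsCompactSub ∧ 𝒴.ballSub (r - ε) ≤ Y' ∧
    x = cGHP ((𝒳.ballSub r).toPMM) Y'.toPMM}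

/-- The quantity `a_ε(𝒳, 𝒴) = a(ε, 1/ε; 𝒳, 𝒴)`. -/
def aEps (ε : ℝ) (𝒳 𝒴 : PMM) : ℝ := aFun ε (1 / ε) 𝒳 𝒴

/-- The Gromov-Hausdorff-Prokhorov distance of boundedly compact pmm spaces
(with `inf ∅ = 1`). -/
def GHP (𝒳 𝒴 : PMM) : ℝ :=
  sInf (insert 1 {ε : ℝ | ε ∈ Set.Ioc (0 : ℝ) 1 ∧ max (aEps ε 𝒳 𝒴) (aEps ε 𝒴 𝒳) < ε / 2})

/-- Two pmm spaces are GHP-isometric if there is a root-preserving measure-preserving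
surjective isometry between them. -/
def GHPIsometric (𝒳 𝒴 : PMM) : Prop :=
  ∃ ρ : 𝒳.carrier → 𝒴.carrier, Isometry ρ ∧ Function.Surjective ρ ∧
    ρ 𝒳.basepoint = 𝒴.basepoint ∧ 𝒳.meas.map ρ = 𝒴.meas

/-- `r` is a continuity radius of a pmm space. -/
def PMM.ContinuityRadius (𝒳 : PMM) (r : ℝ) : Prop :=
  0 < r ∧ Metric.closedBall 𝒳.basepoint r = closure (Metric.ball 𝒳.basepoint r) ∧
    𝒳.meas (Metric.closedBall 𝒳.basepoint r \ Metric.ball 𝒳.basepoint r) = 0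


/-- A relation witnessing closeness of two pmm-subspaces. -/
structure IsRel {𝒳 𝒴 : PMM} (S : SubPMM 𝒳) (T : SubPMM 𝒴) (δ : ℝ)
    (R : 𝒳.carrier → 𝒴.carrier → Prop) : Prop where
  root : R 𝒳.basepoint 𝒴.basepoint
  mem : ∀ x y, R x y → x ∈ S.set ∧ y ∈ T.set
  left : ∀ x ∈ S.set, ∃ y, R x y
  right : ∀ y ∈ T.set, ∃ x, R x y
  dist_le : ∀ x y x' y', R x y → R x' y' → |dist x x' - dist y y'| ≤ 2 * δ
  meas_left : ∀ A : Set 𝒳.carrier, S.meas A ≤ T.meas {y | ∃ x ∈ A, R x y} + ENNReal.ofReal δ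
  meas_right : ∀ A : Set 𝒴.carrier, T.meas A ≤ S.meas {x | ∃ y ∈ A, R x y} + ENNReal.ofReal δ

theorem IsRel.comp {𝒳 𝒴 𝒵 : PMM} {S : SubPMM 𝒳} {T : SubPMM 𝒴} {U : SubPMM 𝒵} {δ δ' : ℝ}
    (hδ : 0 ≤ δ) (hδ' : 0 ≤ δ')
    {R : 𝒳.carrier → 𝒴.carrier → Prop} {R' : 𝒴.carrier → 𝒵.carrier → Prop}
    (h : IsRel S T δ R) (h' : IsRel T U δ' R') :
    IsRel S U (δ + δ') (fun x z => ∃ y, R x y ∧ R' y z) where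
  root := ⟨_, h.root, h'.root⟩
  mem := fun x z ⟨y, h1, h2⟩ => ⟨(h.mem _ _ h1).1, (h'.mem _ _ h2).2⟩
  left := fun x hx => by
    obtain ⟨y, hy⟩ := h.left x hx
    obtain ⟨z, hz⟩ := h'.left y (h.mem _ _ hy).2
    exact ⟨z, y, hy, hz⟩
  right := fun z hz => by
    obtain ⟨y, hy⟩ := h'.right z hz
    obtain ⟨x, hx⟩ := h.right y (h'.mem _ _ hy).1
    exact ⟨x, y, hx, hy⟩
  dist_le := fun x z x' z' ⟨y, h1, h2⟩ ⟨y', h1', h2'⟩ => by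
    have := abs_le.1 (h.dist_le _ _ _ _ h1 h1')
    have := abs_le.1 (h'.dist_le _ _ _ _ h2 h2')
    rw [abs_le]
    constructor <;> linarith
  meas_left := fun A => by
    rw [ENNReal.ofReal_add hδ hδ', add_comm (ENNReal.ofReal δ), ← add_assoc]
    refine (h.meas_left A).trans (add_le_add_left ((h'.meas_left _).trans
      (add_le_add_left (measure_mono ?_) _)) _)
    rintro z ⟨y, ⟨x, hx, hxy⟩, hyz⟩
    exact ⟨x, hx, y, hxy, hyz⟩
  meas_right := fun A => by
    rw [ENNReal.ofReal_add hδ hδ', ← add_assoc]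
    refine (h'.meas_right A).trans (add_le_add_left ((h.meas_right _).trans
      (add_le_add_left (measure_mono ?_) _)) _)
    rintro x ⟨y, ⟨z, hz, hyz⟩, hxy⟩
    exact ⟨z, hz, y, hxy, hyz⟩

theorem toPMM_meas_apply {𝒳 : PMM} {S : SubPMM 𝒳} (hS : S.IsCompactSub)
    (B : Set ↥S.set) : S.toPMM.meas B = S.meas (Subtype.val '' B) := by
  have hm : MeasurableSet S.set := hS.1.isClosed.measurableSet
  have he : @MeasurableEmbedding ↥S.set 𝒳.carrier (borel ↥S.set) _ Subtype.val := by
    have hb : (borel ↥S.set) = Subtype.instMeasurableSpace :=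
      (BorelSpace.measurable_eq (α := ↥S.set)).symm
    rw [hb]
    exact MeasurableEmbedding.subtype_coe hm
  exact he.comap_apply _ _

theorem map_toPMM_apply {𝒳 : PMM} {S : SubPMM 𝒳} (hS : S.IsCompactSub)
    {Z : Type} [MetricSpace Z] (f : S.toPMM.carrier → Z) (hf : Isometry f) (A : Set Z)
    (hA : IsClosed A) :
    (@Measure.map _ _ _ (borel Z) f S.toPMM.meas) A
      = S.meas {x | ∃ hx : x ∈ S.set, f ⟨x, hx⟩ ∈ A} := by
  let _ : MeasurableSpace Z := borel Z
  have : BorelSpace Z := ⟨rfl⟩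
  rw [Measure.map_apply hf.continuous.measurable hA.measurableSet]
  refine (toPMM_meas_apply hS _).trans ?_
  congr 1
  ext x
  constructor
  · rintro ⟨⟨y, hy⟩, h, rfl⟩
    exact ⟨hy, h⟩
  · rintro ⟨hx, h⟩
    exact ⟨⟨x, hx⟩, h, rfl⟩

theorem sub_meas_inter {𝒳 : PMM} (S : SubPMM 𝒳) (A : Set 𝒳.carrier) :
    S.meas A = S.meas (A ∩ S.set) := by
  refine le_antisymm ?_ (measure_mono Set.inter_subset_left)
  calc S.meas A ≤ S.meas ((A ∩ S.set) ∪ S.setᶜ) := measure_mono (fun x hx => by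
        by_cases h : x ∈ S.set
        · exact Or.inl ⟨hx, h⟩
        · exact Or.inr h)
    _ ≤ S.meas (A ∩ S.set) + S.meas S.setᶜ := measure_union_le _ _
    _ = S.meas (A ∩ S.set) := by rw [S.supported, add_zero]

theorem value_nonneg {𝒳 𝒴 : PMM} (e : GHPEmbedding 𝒳 𝒴) : 0 ≤ e.value :=
  le_max_of_le_left dist_nonneg

theorem cGHP_nonneg (𝒳 𝒴 : PMM) : 0 ≤ cGHP 𝒳 𝒴 := by
  apply Real.sInf_nonneg
  rintro x ⟨e, -, rfl⟩
  exact value_nonneg e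

theorem IsRel.exists_embedding {𝒳 𝒴 : PMM} {S : SubPMM 𝒳} {T : SubPMM 𝒴}
    (hS : S.IsCompactSub) (hT : T.IsCompactSub) {δ : ℝ} (hδ : 0 < δ)
    {R : 𝒳.carrier → 𝒴.carrier → Prop} (h : IsRel S T δ R) :
    ∃ e : GHPEmbedding S.toPMM T.toPMM, e.IsIsometric ∧ e.value ≤ δ := by
  let P := {p : ↥S.set × ↥T.set // R p.1.1 p.2.1}
  let Φ : P → ↥S.set := fun p => p.1.1
  let Ψ : P → ↥T.set := fun p => p.1.2
  have : Nonempty P := ⟨⟨⟨⟨_, S.root_mem⟩, ⟨_, T.root_mem⟩⟩, h.root⟩⟩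
  have H : ∀ p q, |dist (Φ p) (Φ q) - dist (Ψ p) (Ψ q)| ≤ 2 * δ :=
    fun p q => h.dist_le _ _ _ _ p.2 q.2
  let mZ : MetricSpace (↥S.set ⊕ ↥T.set) := Metric.glueMetricApprox Φ Ψ δ hδ H
  have hinl : Isometry (Sum.inl : ↥S.set → ↥S.set ⊕ ↥T.set) := Isometry.of_dist_eq fun x y => rfl
  have hinr : Isometry (Sum.inr : ↥T.set → ↥S.set ⊕ ↥T.set) := Isometry.of_dist_eq fun x y => rfl
  have hglue : ∀ x y (hx : x ∈ S.set) (hy : y ∈ T.set), R x y →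
      dist (Sum.inl ⟨x, hx⟩ : ↥S.set ⊕ ↥T.set) (Sum.inr ⟨y, hy⟩) = δ := fun x y hx hy hR =>
    Metric.glueDist_glued_points Φ Ψ δ ⟨⟨⟨x, hx⟩, ⟨y, hy⟩⟩, hR⟩
  refine ⟨⟨↥S.set ⊕ ↥T.set, mZ, Sum.inl, Sum.inr⟩, ⟨hinl, hinr⟩, ?_⟩
  refine max_le ?_ (max_le ?_ ?_)
  · exact (hglue _ _ S.root_mem T.root_mem h.root).le
  · refine Metric.hausdorffDist_le_of_mem_dist hδ.le ?_ ?_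
    · rintro _ ⟨⟨x, hx⟩, rfl⟩
      obtain ⟨y, hy⟩ := h.left x hx
      exact ⟨_, ⟨⟨y, (h.mem _ _ hy).2⟩, rfl⟩, (hglue _ _ hx (h.mem _ _ hy).2 hy).le⟩
    · rintro _ ⟨⟨y, hy⟩, rfl⟩
      obtain ⟨x, hx⟩ := h.right y hy
      refine ⟨_, ⟨⟨x, (h.mem _ _ hx).1⟩, rfl⟩, ?_⟩
      rw [dist_comm]
      exact (hglue _ _ (h.mem _ _ hx).1 hy hx).le
  · refine csInf_le ⟨0, fun x hx => hx.1.le⟩ ⟨hδ, fun A hA => ⟨?_, ?_⟩⟩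
    · have e1 := map_toPMM_apply (Z := ↥S.set ⊕ ↥T.set) hS Sum.inl hinl A hA
      have e2 := map_toPMM_apply (Z := ↥S.set ⊕ ↥T.set) hT Sum.inr hinr (Metric.cthickening δ A)
        Metric.isClosed_cthickening
      refine e1.le.trans (((h.meas_left _).trans (add_le_add_left (measure_mono ?_) _)).trans_eq
        (congrArg (· + ENNReal.ofReal δ) e2.symm))
      rintro y ⟨x, ⟨hx, hxA⟩, hR⟩
      refine ⟨(h.mem _ _ hR).2, Metric.mem_cthickening_of_dist_le _ _ _ _ hxA ?_⟩
      exact (dist_comm _ _).trans_le (hglue _ _ hx (h.mem _ _ hR).2 hR).le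
    · have e1 := map_toPMM_apply (Z := ↥S.set ⊕ ↥T.set) hT Sum.inr hinr A hA
      have e2 := map_toPMM_apply (Z := ↥S.set ⊕ ↥T.set) hS Sum.inl hinl (Metric.cthickening δ A)
        Metric.isClosed_cthickening
      refine e1.le.trans (((h.meas_right _).trans (add_le_add_left (measure_mono ?_) _)).trans_eq
        (congrArg (· + ENNReal.ofReal δ) e2.symm))
      rintro x ⟨y, ⟨hy, hyA⟩, hR⟩
      refine ⟨(h.mem _ _ hR).1, Metric.mem_cthickening_of_dist_le _ _ _ _ hyA ?_⟩
      exact (hglue _ _ (h.mem _ _ hR).1 hy hR).le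

theorem IsRel.cGHP_le {𝒳 𝒴 : PMM} {S : SubPMM 𝒳} {T : SubPMM 𝒴}
    (hS : S.IsCompactSub) (hT : T.IsCompactSub) {δ : ℝ} (hδ : 0 < δ)
    {R : 𝒳.carrier → 𝒴.carrier → Prop} (h : IsRel S T δ R) :
    cGHP S.toPMM T.toPMM ≤ δ := by
  obtain ⟨e, he, hv⟩ := h.exists_embedding hS hT hδ
  have hm : e.value ∈ {x : ℝ | ∃ e : GHPEmbedding S.toPMM T.toPMM, e.IsIsometric ∧ x = e.value} :=
    ⟨e, he, rfl⟩
  refine (csInf_le ⟨0, ?_⟩ hm).trans hv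
  rintro x ⟨e, -, rfl⟩
  exact value_nonneg e

theorem exists_embedding {𝒳 𝒴 : PMM} {S : SubPMM 𝒳} {T : SubPMM 𝒴}
    (hS : S.IsCompactSub) (hT : T.IsCompactSub) :
    ∃ e : GHPEmbedding S.toPMM T.toPMM, e.IsIsometric := by
  obtain ⟨C, hC⟩ := Metric.isBounded_iff.1 hS.1.isBounded
  obtain ⟨D, hD⟩ := Metric.isBounded_iff.1 hT.1.isBounded
  have hC0 : 0 ≤ C := dist_nonneg.trans (hC S.root_mem S.root_mem)
  have hD0 : 0 ≤ D := dist_nonneg.trans (hD T.root_mem T.root_mem)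
  have hm : 0 ≤ (S.meas Set.univ).toReal := ENNReal.toReal_nonneg
  have hn : 0 ≤ (T.meas Set.univ).toReal := ENNReal.toReal_nonneg
  have : IsRel S T (C + D + (S.meas Set.univ).toReal + (T.meas Set.univ).toReal + 1)
      (fun x y => x ∈ S.set ∧ y ∈ T.set) :=
    { root := ⟨S.root_mem, T.root_mem⟩
      mem := fun x y h => h
      left := fun x hx => ⟨_, hx, T.root_mem⟩
      right := fun x hx => ⟨_, S.root_mem, hx⟩
      dist_le := fun x y x' y' h h' => by
        have h1 := hC h.1 h'.1
        have h2 := hD h.2 h'.2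
        have h3 : 0 ≤ dist x x' := dist_nonneg
        have h4 : 0 ≤ dist y y' := dist_nonneg
        rw [abs_le]
        constructor <;> linarith
      meas_left := fun A => by
        refine le_add_left ((measure_mono (Set.subset_univ _)).trans ?_)
        rw [ENNReal.le_ofReal_iff_toReal_le hS.2 (by linarith)]
        linarith
      meas_right := fun A => by
        refine le_add_left ((measure_mono (Set.subset_univ _)).trans ?_)
        rw [ENNReal.le_ofReal_iff_toReal_le hT.2 (by linarith)]
        linarith }
  obtain ⟨e, he, -⟩ := this.exists_embedding hS hT (by linarith)
  exact ⟨e, he⟩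

theorem half_meas {𝒳 𝒴 : PMM} {S : SubPMM 𝒳} {T : SubPMM 𝒴}
    (hS : S.IsCompactSub) (hT : T.IsCompactSub) {Z : Type} [MetricSpace Z]
    (f : S.toPMM.carrier → Z) (hf : Isometry f) (g : T.toPMM.carrier → Z) (hg : Isometry g)
    {ε δ : ℝ} (h0 : 0 < ε) (hεδ : ε < δ)
    (h : ∀ A : Set Z, IsClosed A → (@Measure.map _ _ _ (borel Z) f S.toPMM.meas) A
      ≤ (@Measure.map _ _ _ (borel Z) g T.toPMM.meas) (Metric.cthickening ε A) + ENNReal.ofReal ε)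
    (A : Set 𝒳.carrier) :
    S.meas A ≤ T.meas {y | ∃ x ∈ A, ∃ hx : x ∈ S.set, ∃ hy : y ∈ T.set,
      dist (f ⟨x, hx⟩) (g ⟨y, hy⟩) < δ} + ENNReal.ofReal δ := by
  set E : Set Z := {z | ∃ x ∈ A, ∃ hx : x ∈ S.set, f ⟨x, hx⟩ = z} with hE
  have h1 := h (closure E) isClosed_closure
  rw [map_toPMM_apply hS f hf _ isClosed_closure, Metric.cthickening_closure,
    map_toPMM_apply hT g hg _ Metric.isClosed_cthickening] at h1
  rw [sub_meas_inter]
  refine (measure_mono ?_).trans (h1.trans (add_le_add (measure_mono ?_)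
    (ENNReal.ofReal_le_ofReal hεδ.le)))
  · rintro x ⟨hxA, hx⟩
    exact ⟨hx, subset_closure ⟨x, hxA, hx, rfl⟩⟩
  · rintro y ⟨hy, hyE⟩
    have := Metric.cthickening_subset_thickening' (h0.trans hεδ) hεδ E hyE
    obtain ⟨_, ⟨x, hxA, hx, rfl⟩, hd⟩ := Metric.mem_thickening_iff.1 this
    rw [dist_comm] at hd
    exact ⟨x, hxA, hx, hy, hd⟩

theorem exists_rel_of_cGHP_lt {𝒳 𝒴 : PMM} {S : SubPMM 𝒳} {T : SubPMM 𝒴}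
    (hS : S.IsCompactSub) (hT : T.IsCompactSub) {δ : ℝ} (h : cGHP S.toPMM T.toPMM < δ) :
    ∃ R, IsRel S T δ R := by
  obtain ⟨e0, he0⟩ := exists_embedding hS hT
  have hm : e0.value ∈
      {x : ℝ | ∃ e : GHPEmbedding S.toPMM T.toPMM, e.IsIsometric ∧ x = e.value} :=
    ⟨e0, he0, rfl⟩
  obtain ⟨_, ⟨⟨Z, mZ, f, g⟩, ⟨hf, hg⟩, rfl⟩, hv⟩ := exists_lt_of_csInf_lt ⟨_, hm⟩ h
  dsimp only at hf hg
  have hv1 := (le_max_left _ _).trans_lt hv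
  have hv2 := ((le_max_left _ _).trans (le_max_right _ _)).trans_lt hv
  have hv3 := ((le_max_right _ _).trans (le_max_right _ _)).trans_lt hv
  dsimp only at hv1 hv2 hv3
  have : CompactSpace S.toPMM.carrier := isCompact_iff_compactSpace.1 hS.1
  have : CompactSpace T.toPMM.carrier := isCompact_iff_compactSpace.1 hT.1
  have hfin : Metric.hausdorffEDist (Set.range f) (Set.range g) ≠ ⊤ :=
    Metric.hausdorffEDist_ne_top_of_nonempty_of_bounded ⟨_, ⟨S.toPMM.basepoint, rfl⟩⟩
      ⟨_, ⟨T.toPMM.basepoint, rfl⟩⟩ (isCompact_range hf.continuous).isBounded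
      (isCompact_range hg.continuous).isBounded
  have hne : {ε : ℝ | 0 < ε ∧ ∀ A : Set Z, IsClosed A →
      (@Measure.map _ _ _ (borel Z) f S.toPMM.meas) A ≤
        (@Measure.map _ _ _ (borel Z) g T.toPMM.meas) (Metric.cthickening ε A)
          + ENNReal.ofReal ε ∧
      (@Measure.map _ _ _ (borel Z) g T.toPMM.meas) A ≤
        (@Measure.map _ _ _ (borel Z) f S.toPMM.meas) (Metric.cthickening ε A)
          + ENNReal.ofReal ε}.Nonempty := by
    have hm : 0 ≤ (S.meas Set.univ).toReal := ENNReal.toReal_nonneg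
    have hn : 0 ≤ (T.meas Set.univ).toReal := ENNReal.toReal_nonneg
    refine ⟨(S.meas Set.univ).toReal + (T.meas Set.univ).toReal + 1, by linarith, fun A hA =>
      ⟨le_add_left ?_, le_add_left ?_⟩⟩
    · rw [map_toPMM_apply hS f hf _ hA]
      refine (measure_mono (Set.subset_univ _)).trans ?_
      rw [ENNReal.le_ofReal_iff_toReal_le hS.2 (by linarith)]
      linarith
    · rw [map_toPMM_apply hT g hg _ hA]
      refine (measure_mono (Set.subset_univ _)).trans ?_
      rw [ENNReal.le_ofReal_iff_toReal_le hT.2 (by linarith)]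
      linarith
  obtain ⟨ε, ⟨hε0, hε⟩, hεδ⟩ := exists_lt_of_csInf_lt hne hv3
  refine ⟨fun x y => ∃ hx : x ∈ S.set, ∃ hy : y ∈ T.set, dist (f ⟨x, hx⟩) (g ⟨y, hy⟩) < δ, ?_⟩
  exact
    { root := ⟨S.root_mem, T.root_mem, hv1⟩
      mem := fun x y ⟨hx, hy, _⟩ => ⟨hx, hy⟩
      left := fun x hx => by
        obtain ⟨_, ⟨⟨y, hy⟩, rfl⟩, hd⟩ :=
          Metric.exists_dist_lt_of_hausdorffDist_lt (Set.mem_range_self (f := f) ⟨x, hx⟩) hv2 hfin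
        exact ⟨y, hx, hy, hd⟩
      right := fun y hy => by
        obtain ⟨_, ⟨⟨x, hx⟩, rfl⟩, hd⟩ :=
          Metric.exists_dist_lt_of_hausdorffDist_lt' (Set.mem_range_self (f := g) ⟨y, hy⟩) hv2 hfin
        exact ⟨x, hx, hy, hd⟩
      dist_le := by
        rintro x y x' y' ⟨hx, hy, hd⟩ ⟨hx', hy', hd'⟩
        have e1 : dist (f ⟨x, hx⟩) (f ⟨x', hx'⟩) = dist x x' := hf.dist_eq _ _
        have e2 : dist (g ⟨y, hy⟩) (g ⟨y', hy'⟩) = dist y y' := hg.dist_eq _ _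
        rw [← e1, ← e2, abs_le]
        have t1 := dist_triangle4 (f ⟨x, hx⟩) (g ⟨y, hy⟩) (g ⟨y', hy'⟩) (f ⟨x', hx'⟩)
        have t2 := dist_triangle4 (g ⟨y, hy⟩) (f ⟨x, hx⟩) (f ⟨x', hx'⟩) (g ⟨y', hy'⟩)
        rw [dist_comm (g ⟨y', hy'⟩)] at t1
        rw [dist_comm (g ⟨y, hy⟩) (f ⟨x, hx⟩)] at t2
        constructor <;> linarith
      meas_left := fun A => half_meas hS hT f hf g hg hε0 hεδ (fun A hA => (hε A hA).1) A
      meas_right := fun A => by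
        refine (half_meas hT hS g hg f hf hε0 hεδ (fun A hA => (hε A hA).2) A).trans
          (add_le_add_left (measure_mono ?_) _)
        rintro x ⟨y, hyA, hy, hx, hd⟩
        rw [dist_comm] at hd
        exact ⟨y, hyA, hx, hy, hd⟩ }

open Classical in
theorem flow_one {I J : Type} [Fintype I] [Fintype J] (m : I → ℝ) (n : J → ℝ)
    (hm : ∀ i, 0 ≤ m i) (hn : ∀ j, 0 ≤ n j) (r : I → J → Prop) {ε η : ℝ} (hε : 0 ≤ ε) (hη : 0 < η)
    (h : ∀ A : Finset I, ∑ i ∈ A, m i ≤ ∑ j with (∃ i ∈ A, r i j), n j + ε) :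
    ∃ α : I → J → ℝ, (∀ i j, 0 ≤ α i j) ∧ (∀ i j, α i j ≠ 0 → r i j) ∧
      (∀ i, ∑ j, α i j ≤ m i) ∧ (∀ j, ∑ i, α i j ≤ n j) ∧
      ∑ i, m i ≤ ∑ i, ∑ j, α i j + ε + η := by
  obtain ⟨N, hN⟩ := exists_nat_gt ((Fintype.card I + Fintype.card J + 1 : ℝ) / η)
  have hN0 : (0 : ℝ) < N := lt_of_le_of_lt (by positivity) hN
  rw [div_lt_iff₀ hη] at hN
  let p : I → ℕ := fun i => ⌊N * m i⌋₊
  let q : J → ℕ := fun j => ⌊N * n j⌋₊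
  let D : ℕ := ⌈N * ε⌉₊ + Fintype.card J
  let L := Σ i, Fin (p i)
  let K := (Σ j, Fin (q j)) ⊕ Fin D
  let ρ : L → K → Prop := fun a b => match b with
    | .inl b => r a.1 b.1
    | .inr _ => True
  have hp : ∀ i, (p i : ℝ) ≤ N * m i := fun i => Nat.floor_le (by have := hm i; positivity)
  have hp' : ∀ i, N * m i ≤ p i + 1 := fun i => (Nat.lt_floor_add_one _).le
  have hq : ∀ i, (q i : ℝ) ≤ N * n i := fun i => Nat.floor_le (by have := hn i; positivity)
  have hq' : ∀ i, N * n i ≤ q i + 1 := fun i => (Nat.lt_floor_add_one _).le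
  have hD1 : N * ε + Fintype.card J ≤ D := by
    have := Nat.le_ceil (N * ε)
    simp only [D]; push_cast; linarith
  have hD2 : (D : ℝ) ≤ N * ε + 1 + Fintype.card J := by
    have := (Nat.ceil_lt_add_one (a := N * ε) (by positivity)).le
    simp only [D]; push_cast; linarith
  have hall : ∀ A : Finset L, A.card ≤ (Finset.univ.filter (fun b => ∃ a ∈ A, ρ a b)).card := by
    intro A
    rcases A.eq_empty_or_nonempty with rfl | ⟨a0, ha0⟩
    · simp
    let B : Finset I := A.image Sigma.fst
    let NB : Finset J := Finset.univ.filter (fun j => ∃ i ∈ B, r i j)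
    have h1 : A.card ≤ ∑ i ∈ B, p i := by
      calc A.card ≤ (B.sigma (fun i => (Finset.univ : Finset (Fin (p i))))).card := by
            apply Finset.card_le_card
            intro a ha
            exact Finset.mem_sigma.2 ⟨Finset.mem_image_of_mem _ ha, Finset.mem_univ _⟩
        _ = ∑ i ∈ B, p i := by simp [Finset.card_sigma]
    have h2 : ((NB.sigma (fun j => (Finset.univ : Finset (Fin (q j))))).disjSum
        (Finset.univ : Finset (Fin D))) ⊆ (Finset.univ.filter (fun b => ∃ a ∈ A, ρ a b)) := by
      intro b hb
      rw [Finset.mem_filter]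
      refine ⟨Finset.mem_univ _, ?_⟩
      rcases b with b | b
      · simp only [Finset.inl_mem_disjSum, Finset.mem_sigma, Finset.mem_univ, and_true, NB,
          Finset.mem_filter, true_and, B, Finset.mem_image] at hb
        obtain ⟨_, ⟨a, ha, rfl⟩, hr⟩ := hb
        exact ⟨a, ha, hr⟩
      · exact ⟨a0, ha0, trivial⟩
    refine (h1.trans ?_).trans (Finset.card_le_card h2)
    rw [Finset.card_disjSum, Finset.card_sigma]
    simp only [Finset.card_univ, Fintype.card_fin]
    have h3 := h B
    have h4 : (∑ i ∈ B, (p i : ℝ)) ≤ N * ∑ i ∈ B, m i := by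
      rw [Finset.mul_sum]; exact Finset.sum_le_sum fun i _ => hp i
    have h5 : N * ∑ j ∈ NB, n j ≤ ∑ j ∈ NB, (q j : ℝ) + Fintype.card J := by
      have : (NB.card : ℝ) ≤ Fintype.card J := by exact_mod_cast Finset.card_le_univ _
      calc N * ∑ j ∈ NB, n j ≤ ∑ j ∈ NB, ((q j : ℝ) + 1) := by
            rw [Finset.mul_sum]; exact Finset.sum_le_sum fun i _ => hq' i
        _ ≤ _ := by rw [Finset.sum_add_distrib]; simpa using this
    have h6 : N * ∑ i ∈ B, m i ≤ N * ∑ j ∈ NB, n j + N * ε := by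
      rw [← mul_add]; exact mul_le_mul_of_nonneg_left h3 hN0.le
    have : (∑ i ∈ B, (p i : ℝ)) ≤ ∑ j ∈ NB, (q j : ℝ) + D := by linarith
    exact_mod_cast this
  obtain ⟨f, hf, hfr⟩ := (Fintype.all_card_le_filter_rel_iff_exists_injective ρ).1 hall
  let M : I → J → Finset L := fun i j =>
    Finset.univ.filter (fun a => a.1 = i ∧ ∃ b, f a = .inl b ∧ b.1 = j)
  have hrow : ∀ i, ∑ j, (M i j).card ≤ p i := by
    intro i
    rw [← Finset.card_biUnion]
    · calc _ ≤ (({i} : Finset I).sigma (fun i => (Finset.univ : Finset (Fin (p i))))).card := by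
            apply Finset.card_le_card
            intro a ha
            simp only [Finset.mem_biUnion, M, Finset.mem_filter] at ha
            obtain ⟨j, -, -, ha, -⟩ := ha
            exact Finset.mem_sigma.2 ⟨Finset.mem_singleton.2 ha, Finset.mem_univ _⟩
        _ = p i := by simp [Finset.card_sigma]
    · intro j _ j' _ hjj
      refine Finset.disjoint_left.2 ?_
      intro a ha ha'
      simp only [M, Finset.mem_filter] at ha ha'
      obtain ⟨-, -, b, hb, rfl⟩ := ha
      obtain ⟨-, -, b', hb', rfl⟩ := ha'
      rw [hb] at hb'
      exact hjj (by rw [Sum.inl.inj hb'])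
  have hcol : ∀ j, ∑ i, (M i j).card ≤ q j := by
    intro j
    rw [← Finset.card_biUnion]
    · calc _ ≤ ((({j} : Finset J).sigma (fun i => (Finset.univ : Finset (Fin (q i))))).map
                ⟨Sum.inl, Sum.inl_injective⟩ : Finset K).card := by
            apply Finset.card_le_card_of_injOn f _ hf.injOn
            intro a ha
            simp only [Finset.coe_biUnion, Set.mem_iUnion, M, Finset.coe_filter,
              Set.mem_ofPred_eq] at ha
            obtain ⟨i, -, -, -, b, hb, hbj⟩ := ha
            rw [hb]
            exact Finset.mem_map_of_mem ⟨Sum.inl, Sum.inl_injective⟩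
              (Finset.mem_sigma.2 ⟨Finset.mem_singleton.2 hbj, Finset.mem_univ _⟩)
        _ = q j := by simp [Finset.card_sigma]
    · intro j _ j' _ hjj
      refine Finset.disjoint_left.2 ?_
      intro a ha ha'
      simp only [M, Finset.mem_filter] at ha ha'
      exact hjj (ha.2.1.symm.trans ha'.2.1)
  have htot : ∑ i, p i ≤ ∑ i, ∑ j, (M i j).card + D := by
    have e1 : ∑ i, p i = (Finset.univ : Finset L).card := by simp [L]
    have e2 : (Finset.univ : Finset L) ⊆ (Finset.univ.biUnion fun i => Finset.univ.biUnion fun j =>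
        M i j) ∪ Finset.univ.filter (fun a => ∃ d, f a = .inr d) := by
      intro a _
      rw [Finset.mem_union]
      rcases hfa : f a with b | d
      · left
        simp only [Finset.mem_biUnion, Finset.mem_univ, true_and, M, Finset.mem_filter]
        exact ⟨a.1, b.1, rfl, b, hfa, rfl⟩
      · right; simp [hfa]
    rw [e1]
    refine (Finset.card_le_card e2).trans ((Finset.card_union_le _ _).trans (add_le_add ?_ ?_))
    · exact Finset.card_biUnion_le.trans (Finset.sum_le_sum fun i _ => Finset.card_biUnion_le)
    · calc _ ≤ ((Finset.univ : Finset (Fin D)).map ⟨Sum.inr, Sum.inr_injective⟩ :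
            Finset K).card := by
            apply Finset.card_le_card_of_injOn f _ hf.injOn
            intro a ha
            simp only [Finset.coe_filter, Set.mem_ofPred_eq] at ha
            obtain ⟨-, d, hd⟩ := ha
            rw [hd]
            simp
        _ = D := by simp
  refine ⟨fun i j => (M i j).card / N, fun i j => by positivity, ?_, ?_, ?_, ?_⟩
  · intro i j hij
    have : (M i j).card ≠ 0 := fun h0 => hij (by simp [h0])
    obtain ⟨a, ha⟩ := Finset.card_pos.1 (Nat.pos_of_ne_zero this)
    simp only [M, Finset.mem_filter] at ha
    obtain ⟨-, rfl, b, hb, rfl⟩ := ha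
    have := hfr a
    rw [hb] at this
    exact this
  · intro i
    rw [← Finset.sum_div, div_le_iff₀ hN0, mul_comm]
    refine le_trans ?_ (hp i)
    exact_mod_cast hrow i
  · intro i
    rw [← Finset.sum_div, div_le_iff₀ hN0, mul_comm]
    refine le_trans ?_ (hq i)
    exact_mod_cast hcol i
  · simp_rw [← Finset.sum_div]
    have t1 : N * ∑ i, m i ≤ ∑ i, (p i : ℝ) + Fintype.card I := by
      calc N * ∑ i, m i ≤ ∑ i, ((p i : ℝ) + 1) := by
            rw [Finset.mul_sum]; exact Finset.sum_le_sum fun i _ => hp' i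
        _ = _ := by rw [Finset.sum_add_distrib]; simp
    have t2 : ∑ i, (p i : ℝ) ≤ ∑ i, ∑ j, ((M i j).card : ℝ) + D := by exact_mod_cast htot
    have t3 : N * ∑ i, m i ≤ ∑ i, ∑ j, ((M i j).card : ℝ) + N * ε + N * η := by linarith
    rw [← sub_nonneg] at t3 ⊢
    have : 0 ≤ (∑ i, ∑ j, ((M i j).card : ℝ) + N * ε + N * η - N * ∑ i, m i) / N := by positivity
    convert this using 1
    field_simp

open Classical in
theorem flow_two {I J : Type} [Fintype I] [Fintype J] (m : I → ℝ) (n : J → ℝ)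
    (hm : ∀ i, 0 ≤ m i) (hn : ∀ j, 0 ≤ n j) (r : I → J → Prop) {ε η : ℝ} (hε : 0 ≤ ε) (hη : 0 < η)
    (h : ∀ A : Finset I, ∑ i ∈ A, m i ≤ ∑ j with (∃ i ∈ A, r i j), n j + ε)
    (h' : ∀ A : Finset J, ∑ j ∈ A, n j ≤ ∑ i with (∃ j ∈ A, r i j), m i + ε) :
    ∃ α : I → J → ℝ, (∀ i j, 0 ≤ α i j) ∧ (∀ i j, α i j ≠ 0 → r i j) ∧
      (∀ i, ∑ j, α i j ≤ m i) ∧ (∀ j, ∑ i, α i j ≤ n j) ∧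
      ∑ i, m i ≤ ∑ i, ∑ j, α i j + ε + η ∧ ∑ j, n j ≤ ∑ i, ∑ j, α i j + ε + η := by
  rcases le_total (∑ j, n j) (∑ i, m i) with hle | hle
  · obtain ⟨α, h1, h2, h3, h4, h5⟩ := flow_one m n hm hn r hε hη h
    exact ⟨α, h1, h2, h3, h4, h5, hle.trans h5⟩
  · obtain ⟨α, h1, h2, h3, h4, h5⟩ := flow_one n m hn hm (fun j i => r i j) hε hη h'
    rw [Finset.sum_comm] at h5
    exact ⟨fun i j => α j i, fun i j => h1 j i, fun i j => h2 j i, h4, h3, hle.trans h5, h5⟩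

theorem exists_partition {X : Type} [MetricSpace X] [MeasurableSpace X] [BorelSpace X]
    {s : Set X} (hs : IsCompact s) {η : ℝ} (hη : 0 < η) :
    ∃ (k : ℕ) (P : Fin k → Set X), (∀ i, MeasurableSet (P i)) ∧ Pairwise (Function.onFun Disjoint P) ∧
      (⋃ i, P i) = s ∧ ∀ i, ∀ x ∈ P i, ∀ y ∈ P i, dist x y ≤ η := by
  obtain ⟨t, -, ht, hst⟩ := hs.finite_cover_balls (half_pos hη)
  obtain ⟨k, g, rfl⟩ : ∃ (k : ℕ) (g : Fin k → X), t = Set.range g := by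
    obtain ⟨k, g, hg⟩ := ht.fin_param
    exact ⟨k, g, hg.2.symm⟩
  let Q : Fin k → Set X := fun i => s ∩ Metric.ball (g i) (η / 2)
  refine ⟨k, disjointed Q, ?_, disjoint_disjointed _, ?_, ?_⟩
  · intro i
    have hQ : ∀ j, MeasurableSet (Q j) := fun j =>
      hs.isClosed.measurableSet.inter measurableSet_ball
    rw [disjointed_eq_inter_compl]
    exact (hQ i).inter (MeasurableSet.iInter fun j => MeasurableSet.iInter fun _ => (hQ j).compl)
  · rw [iUnion_disjointed]
    ext x
    simp only [Q, Set.mem_iUnion, Set.mem_inter_iff]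
    constructor
    · rintro ⟨i, h, -⟩; exact h
    · intro hx
      have := hst hx
      simp only [Set.mem_iUnion, Set.mem_range] at this
      obtain ⟨_, ⟨i, rfl⟩, hi⟩ := this
      exact ⟨i, hx, hi⟩
  · intro i x hx y hy
    have hx' := ((disjointed_subset Q i) hx).2
    have hy' := ((disjointed_subset Q i) hy).2
    rw [Metric.mem_ball] at hx' hy'
    have := dist_triangle_right x y (g i)
    linarith

open Classical in
theorem finite_restrict {I J : Type} [Fintype I] [Fintype J] (m m' : I → ℝ) (n : J → ℝ)
    (hm' : ∀ i, 0 ≤ m' i) (hmm : ∀ i, m' i ≤ m i) (hn : ∀ j, 0 ≤ n j) (r : I → J → Prop)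
    {ε η : ℝ} (hε : 0 ≤ ε) (hη : 0 < η)
    (h : ∀ A : Finset I, ∑ i ∈ A, m i ≤ ∑ j with (∃ i ∈ A, r i j), n j + ε)
    (h' : ∀ A : Finset J, ∑ j ∈ A, n j ≤ ∑ i with (∃ j ∈ A, r i j), m i + ε) :
    ∃ c : J → ℝ, (∀ j, 0 ≤ c j) ∧ (∀ j, c j ≤ 1) ∧
      (∀ A : Finset I, ∑ i ∈ A, m' i ≤ ∑ j with (∃ i ∈ A, r i j), c j * n j + (ε + η)) ∧
      (∀ A : Finset J, ∑ j ∈ A, c j * n j ≤ ∑ i with (∃ j ∈ A, r i j), m' i + (ε + η)) ∧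
      (∀ j, (∀ i, r i j → m' i = m i) → c j = 1) := by
  have hm : ∀ i, 0 ≤ m i := fun i => (hm' i).trans (hmm i)
  obtain ⟨α, α0, αr, αm, αn, αtm, αtn⟩ := flow_two m n hm hn r hε hη h h'
  let f : I → ℝ := fun i => m' i / m i
  have f0 : ∀ i, 0 ≤ f i := fun i => div_nonneg (hm' i) (hm i)
  have f1 : ∀ i, f i ≤ 1 := fun i => div_le_one_of_le₀ (hmm i) (hm i)
  have fm : ∀ i, f i * m i = m' i := fun i => by
    by_cases h0 : m i = 0
    · rw [h0, mul_zero]; exact le_antisymm (hm' i) (h0 ▸ hmm i)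
    · exact div_mul_cancel₀ _ h0
  let γ : J → ℝ := fun j => ∑ i, α i j * (1 - f i)
  have γ0 : ∀ j, 0 ≤ γ j := fun j => Finset.sum_nonneg fun i _ =>
    mul_nonneg (α0 i j) (sub_nonneg.2 (f1 i))
  have γn : ∀ j, γ j ≤ n j := fun j => (Finset.sum_le_sum fun i _ =>
    mul_le_of_le_one_right (α0 i j) (by linarith [f0 i])).trans (αn j)
  let c : J → ℝ := fun j => 1 - γ j / n j
  have cn : ∀ j, c j * n j = n j - γ j := fun j => by
    by_cases h0 : n j = 0
    · have : γ j = 0 := le_antisymm (h0 ▸ γn j) (γ0 j)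
      rw [h0, this]; simp
    · simp only [c]; field_simp
  have hβ : ∀ j, ∑ i, f i * α i j = ∑ i, α i j - γ j := fun j => by
    simp only [γ]
    rw [← Finset.sum_sub_distrib]
    exact Finset.sum_congr rfl fun i _ => by ring
  have c0 : ∀ j, 0 ≤ c j := fun j => sub_nonneg.2 (div_le_one_of_le₀ (γn j) (hn j))
  have fα0 : ∀ i j, 0 ≤ f i * α i j := fun i j => mul_nonneg (f0 i) (α0 i j)
  refine ⟨c, c0, fun j => ?_, fun A => ?_, fun A => ?_, fun j hj => ?_⟩
  · have := div_nonneg (γ0 j) (hn j)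
    simp only [c]; linarith
  · have e1 : ∑ i ∈ A, m' i = ∑ i ∈ A, f i * (m i - ∑ j, α i j) + ∑ j, ∑ i ∈ A, f i * α i j := by
      rw [Finset.sum_comm, ← Finset.sum_add_distrib]
      refine Finset.sum_congr rfl fun i _ => ?_
      rw [← Finset.mul_sum, mul_sub, fm]; ring
    have e2 : ∑ i ∈ A, f i * (m i - ∑ j, α i j) ≤ ε + η := by
      calc _ ≤ ∑ i ∈ A, (m i - ∑ j, α i j) := Finset.sum_le_sum fun i _ =>
            mul_le_of_le_one_left (sub_nonneg.2 (αm i)) (f1 i)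
        _ ≤ ∑ i, (m i - ∑ j, α i j) := Finset.sum_le_univ_sum_of_nonneg fun i =>
            sub_nonneg.2 (αm i)
        _ ≤ _ := by rw [Finset.sum_sub_distrib]; linarith
    have e3 : ∑ j, ∑ i ∈ A, f i * α i j ≤ ∑ j with (∃ i ∈ A, r i j), c j * n j := by
      rw [Finset.sum_filter]
      refine Finset.sum_le_sum fun j _ => ?_
      split_ifs with hj
      · calc _ ≤ ∑ i, f i * α i j := Finset.sum_le_univ_sum_of_nonneg fun i => fα0 i j
          _ ≤ _ := by rw [hβ, cn]; linarith [αn j]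
      · refine (Finset.sum_eq_zero fun i hi => ?_).le
        have : α i j = 0 := by
          by_contra h0
          exact hj ⟨i, hi, αr i j h0⟩
        rw [this, mul_zero]
    linarith
  · have e1 : ∑ j ∈ A, c j * n j = ∑ j ∈ A, (n j - ∑ i, α i j) + ∑ i, ∑ j ∈ A, f i * α i j := by
      rw [Finset.sum_comm, ← Finset.sum_add_distrib]
      refine Finset.sum_congr rfl fun j _ => ?_
      rw [hβ, cn]; ring
    have e2 : ∑ j ∈ A, (n j - ∑ i, α i j) ≤ ε + η := by
      calc _ ≤ ∑ j, (n j - ∑ i, α i j) := Finset.sum_le_univ_sum_of_nonneg fun j =>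
            sub_nonneg.2 (αn j)
        _ ≤ _ := by rw [Finset.sum_sub_distrib, Finset.sum_comm]; linarith
    have e3 : ∑ i, ∑ j ∈ A, f i * α i j ≤ ∑ i with (∃ j ∈ A, r i j), m' i := by
      rw [Finset.sum_filter]
      refine Finset.sum_le_sum fun i _ => ?_
      split_ifs with hj
      · calc _ ≤ ∑ j, f i * α i j := Finset.sum_le_univ_sum_of_nonneg fun j => fα0 i j
          _ ≤ _ := by
            rw [← Finset.mul_sum, ← fm]
            exact mul_le_mul_of_nonneg_left (αm i) (f0 i)
      · refine (Finset.sum_eq_zero fun j hi => ?_).le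
        have : α i j = 0 := by
          by_contra h0
          exact hj ⟨j, hi, αr i j h0⟩
        rw [this, mul_zero]
    linarith
  · have : γ j = 0 := Finset.sum_eq_zero fun i _ => by
      by_cases h0 : α i j = 0
      · rw [h0, zero_mul]
      · have h1 := hj i (αr i j h0)
        have h2 : 0 < α i j := lt_of_le_of_ne (α0 i j) (Ne.symm h0)
        have h3 : α i j ≤ m i :=
          (Finset.single_le_sum (fun k _ => α0 i k) (Finset.mem_univ j)).trans (αm i)
        have : f i = 1 := by
          simp only [f]; rw [h1]; exact div_self (by linarith)
        rw [this]; ring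
    simp only [c]; rw [this]; simp

theorem mem_ballSub {𝒳 : PMM} {r : ℝ} (hr : 0 ≤ r) (x : 𝒳.carrier) :
    x ∈ (𝒳.ballSub r).set ↔ dist x 𝒳.basepoint ≤ r := by
  constructor
  · rintro (rfl | h)
    · simpa using hr
    · exact h
  · exact fun h => Or.inr h

theorem ballSub_set {𝒳 : PMM} {r : ℝ} (hr : 0 ≤ r) :
    (𝒳.ballSub r).set = Metric.closedBall 𝒳.basepoint r :=
  Set.ext fun x => mem_ballSub hr x

theorem ballSub_meas {𝒳 : PMM} (r : ℝ) :
    (𝒳.ballSub r).meas = 𝒳.meas.restrict (𝒳.ballSub r).set := rfl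

theorem measurableSet_ballSub {𝒳 : PMM} (r : ℝ) : MeasurableSet (𝒳.ballSub r).set :=
  measurableSet_closedBall.insert 𝒳.basepoint

open Classical in
theorem sum_pieces_le {𝒳 𝒴 : PMM} {S : SubPMM 𝒳} {T : SubPMM 𝒴} (hS : S.IsCompactSub)
    (hT : T.IsCompactSub) {I J : Type} [Fintype I] [Fintype J]
    (P : I → Set 𝒳.carrier) (Q : J → Set 𝒴.carrier) (hP : ∀ i, MeasurableSet (P i))
    (hPd : Pairwise (Function.onFun Disjoint P)) (hQU : (⋃ j, Q j) = T.set)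
    {δ : ℝ} (h0 : 0 ≤ δ) (R : 𝒳.carrier → 𝒴.carrier → Prop)
    (h : ∀ A : Set 𝒳.carrier, S.meas A ≤ T.meas {y | ∃ x ∈ A, R x y} + ENNReal.ofReal δ)
    (A : Finset I) :
    ∑ i ∈ A, (S.meas (P i)).toReal ≤
      ∑ j with (∃ i ∈ A, ∃ x ∈ P i, ∃ y ∈ Q j, R x y), (T.meas (Q j)).toReal + δ := by
  have fS : ∀ B, S.meas B ≠ ⊤ := fun B => ne_top_of_le_ne_top hS.2 (measure_mono B.subset_univ)
  have fT : ∀ B, T.meas B ≠ ⊤ := fun B => ne_top_of_le_ne_top hT.2 (measure_mono B.subset_univ)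
  have h1 : ∑ i ∈ A, S.meas (P i) ≤
      ∑ j with (∃ i ∈ A, ∃ x ∈ P i, ∃ y ∈ Q j, R x y), T.meas (Q j) + ENNReal.ofReal δ := by
    rw [← measure_biUnion_finset (fun i _ j _ hij => hPd hij) (fun i _ => hP i)]
    refine (h _).trans (add_le_add_left ?_ _)
    rw [sub_meas_inter]
    refine (measure_mono ?_).trans (measure_biUnion_finset_le _ _)
    rintro y ⟨⟨x, hx, hR⟩, hy⟩
    rw [← hQU] at hy
    simp only [Set.mem_iUnion] at hx hy ⊢
    obtain ⟨i, hi, hx⟩ := hx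
    obtain ⟨j, hj⟩ := hy
    exact ⟨j, by simpa using ⟨i, hi, x, hx, y, hj, hR⟩, hj⟩
  rw [← ENNReal.toReal_sum (fun i _ => fS _), ← ENNReal.toReal_sum (fun i _ => fT _)]
  have h2 : ∑ j with (∃ i ∈ A, ∃ x ∈ P i, ∃ y ∈ Q j, R x y), T.meas (Q j) ≠ ⊤ :=
    ENNReal.sum_ne_top.2 fun j _ => fT _
  have h3 := ENNReal.toReal_mono (ENNReal.add_ne_top.2 ⟨h2, ENNReal.ofReal_ne_top⟩) h1
  rwa [ENNReal.toReal_add h2 ENNReal.ofReal_ne_top, ENNReal.toReal_ofReal h0] at h3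

open Classical in
theorem restrict_rel {𝒳 𝒴 : PMM} {S S' : SubPMM 𝒳} {T : SubPMM 𝒴} (hS : S.IsCompactSub)
    (hS' : S'.IsCompactSub) (hT : T.IsCompactSub) {δ δ' : ℝ} (h0 : 0 ≤ δ) (hδ : δ < δ')
    {R : 𝒳.carrier → 𝒴.carrier → Prop} (h : IsRel S T δ R) (hle : S' ≤ S) {ρ ρ' : ℝ} (hρ0 : 0 ≤ ρ)
    (hρ : ρ + 2 * δ' ≤ ρ') (hb : 𝒳.ballSub ρ' ≤ S') (hb' : 𝒴.ballSub ρ ≤ T) :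
    ∃ T' : SubPMM 𝒴, T'.IsCompactSub ∧ T' ≤ T ∧ 𝒴.ballSub ρ ≤ T' ∧ ∃ R', IsRel S' T' δ' R' := by
  obtain ⟨η, hη⟩ : ∃ η, η = (δ' - δ) / 3 := ⟨_, rfl⟩
  have hη0 : 0 < η := by rw [hη]; linarith
  have hρ'0 : 0 ≤ ρ' := by linarith
  obtain ⟨k, P, hP, hPd, hPU, hPη⟩ := exists_partition hS.1 hη0
  obtain ⟨l, Q, hQ, hQd, hQU, hQη⟩ := exists_partition hT.1 hη0
  let r : Fin k → Fin l → Prop := fun i j => ∃ x ∈ P i, ∃ y ∈ Q j, R x y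
  have fS : ∀ B, S.meas B ≠ ⊤ := fun B => ne_top_of_le_ne_top hS.2 (measure_mono B.subset_univ)
  have fS' : ∀ B, S'.meas B ≠ ⊤ := fun B => ne_top_of_le_ne_top hS'.2 (measure_mono B.subset_univ)
  have fT : ∀ B, T.meas B ≠ ⊤ := fun B => ne_top_of_le_ne_top hT.2 (measure_mono B.subset_univ)
  obtain ⟨c, c0, c1, hc1, hc2, hc3⟩ := finite_restrict (fun i => (S.meas (P i)).toReal)
    (fun i => (S'.meas (P i)).toReal) (fun j => (T.meas (Q j)).toReal)
    (fun i => ENNReal.toReal_nonneg) (fun i => ENNReal.toReal_mono (fS _) (hle.2 _))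
    (fun j => ENNReal.toReal_nonneg) r h0 hη0
    (fun A => sum_pieces_le hS hT P Q hP hPd hQU h0 R h.meas_left A)
    (fun A => by
      refine (sum_pieces_le hT hS Q P hQ hQd hPU h0 (fun y x => R x y) h.meas_right A).trans_eq ?_
      congr 2
      ext i
      simp only [Finset.mem_filter, Finset.mem_univ, true_and, r]
      constructor
      · rintro ⟨j, hj, y, hy, x, hx, hR⟩
        exact ⟨j, hj, x, hx, y, hy, hR⟩
      · rintro ⟨j, hj, x, hx, y, hy, hR⟩
        exact ⟨j, hj, y, hy, x, hx, hR⟩)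
  let E : Set 𝒴.carrier := {y | y ∈ T.set ∧ ∃ x ∈ S'.set, ∃ x' y', R x' y' ∧ dist x x' ≤ η ∧
    dist y y' ≤ η}
  have hET : E ⊆ T.set := fun y hy => hy.1
  have hclT : closure E ⊆ T.set := closure_minimal hET hT.1.isClosed
  have hEm : MeasurableSet (closure E) := isClosed_closure.measurableSet
  let ν0 : Measure 𝒴.carrier := ∑ j, ENNReal.ofReal (c j) • T.meas.restrict (Q j)
  have hν0 : ∀ B, MeasurableSet B → ν0 B = ∑ j, ENNReal.ofReal (c j) * T.meas (B ∩ Q j) := by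
    intro B hB
    simp only [ν0, Measure.coe_finsetSum, Finset.sum_apply, Measure.smul_apply, smul_eq_mul,
      Measure.restrict_apply hB]
  have hTsum : ∀ B, MeasurableSet B → T.meas B = ∑ j, T.meas (B ∩ Q j) := by
    intro B hB
    rw [sub_meas_inter, ← hQU, Set.inter_iUnion, measure_iUnion]
    · rw [tsum_fintype]
    · intro i j hij
      exact (hQd hij).mono Set.inter_subset_right Set.inter_subset_right
    · exact fun j => hB.inter (hQ j)
  have hν0T : ν0 ≤ T.meas := by
    rw [Measure.le_iff]
    intro B hB
    rw [hν0 B hB, hTsum B hB]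
    refine Finset.sum_le_sum fun j _ => ?_
    calc _ ≤ 1 * T.meas (B ∩ Q j) := by
          gcongr
          exact ENNReal.ofReal_le_one.2 (c1 j)
      _ = _ := one_mul _
  have hν0Q : ∀ j, ν0 (Q j) = ENNReal.ofReal (c j * (T.meas (Q j)).toReal) := by
    intro j
    rw [hν0 _ (hQ j), Finset.sum_eq_single j]
    · rw [Set.inter_self, ENNReal.ofReal_mul (c0 j), ENNReal.ofReal_toReal (fT _)]
    · intro i _ hij
      rw [(hQd hij.symm).inter_eq]; simp
    · simp
  have hroot : 𝒴.basepoint ∈ E :=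
    ⟨T.root_mem, 𝒳.basepoint, S'.root_mem, _, _, h.root, by simpa using hη0.le, by simpa using hη0.le⟩
  let T' : SubPMM 𝒴 :=
    { set := closure E
      root_mem := subset_closure hroot
      meas := ν0.restrict (closure E)
      meas_le := Measure.restrict_le_self.trans (hν0T.trans T.meas_le)
      supported := by rw [Measure.restrict_apply hEm.compl, Set.compl_inter_self]; simp }
  have hT'T : T'.meas ≤ T.meas := Measure.restrict_le_self.trans hν0T
  have hballE : (𝒴.ballSub ρ).set ⊆ E := by
    intro y hy
    obtain ⟨x, hx⟩ := h.right y (hb'.1 hy)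
    refine ⟨hb'.1 hy, x, hb.1 ?_, x, y, hx, by simpa using hη0.le, by simpa using hη0.le⟩
    rw [mem_ballSub hρ0] at hy
    rw [mem_ballSub hρ'0]
    have := abs_le.1 (h.dist_le _ _ _ _ hx h.root)
    linarith
  have hcball : ∀ j, (Q j ∩ (𝒴.ballSub ρ).set).Nonempty → c j = 1 := by
    rintro j ⟨y, hyj, hy⟩
    refine hc3 j ?_
    rintro i ⟨x, hx, y', hy', hR⟩
    have hsub : P i ⊆ (𝒳.ballSub ρ').set := by
      intro z hz
      rw [mem_ballSub hρ0] at hy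
      rw [mem_ballSub hρ'0]
      have e1 := abs_le.1 (h.dist_le _ _ _ _ hR h.root)
      have e2 := hPη i z hz x hx
      have e3 := hQη j y' hy' y hyj
      have e4 := dist_triangle z x 𝒳.basepoint
      have e5 := dist_triangle y' y 𝒴.basepoint
      linarith
    have e1 : S.meas (P i) ≤ S'.meas (P i) := by
      calc S.meas (P i) ≤ 𝒳.meas (P i) := S.meas_le _
        _ = (𝒳.ballSub ρ').meas (P i) := by
          rw [ballSub_meas, Measure.restrict_apply (hP i), Set.inter_eq_self_of_subset_left hsub]
        _ ≤ _ := hb.2 _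
    exact congrArg ENNReal.toReal (le_antisymm (hle.2 _) e1)
  refine ⟨T', ⟨hT.1.of_isClosed_subset isClosed_closure hclT, ?_⟩, ⟨hclT, hT'T⟩,
    ⟨hballE.trans subset_closure, ?_⟩, fun x y => x ∈ S'.set ∧ y ∈ closure E ∧
      ∃ x' y', R x' y' ∧ dist x x' ≤ η ∧ dist y y' ≤ 2 * η, ?_⟩
  · exact ne_top_of_le_ne_top (fT _) (hT'T _)
  · rw [Measure.le_iff]
    intro B hB
    have hK := measurableSet_ballSub (𝒳 := 𝒴) ρ
    have e0 : (𝒴.ballSub ρ).meas B = (𝒴.ballSub ρ).meas (B ∩ (𝒴.ballSub ρ).set) :=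
      sub_meas_inter _ _
    rw [e0]
    refine (hb'.2 _).trans (le_trans ?_ (measure_mono (Set.inter_subset_left (t := (𝒴.ballSub ρ).set))))
    change _ ≤ (ν0.restrict (closure E)) _
    rw [Measure.restrict_apply (hB.inter hK), Set.inter_eq_self_of_subset_left
      (Set.inter_subset_right.trans (hballE.trans subset_closure)), hν0 _ (hB.inter hK),
      hTsum _ (hB.inter hK)]
    refine Finset.sum_le_sum fun j _ => ?_
    by_cases hne : (Q j ∩ (𝒴.ballSub ρ).set).Nonempty
    · rw [hcball j hne]; simp
    · rw [Set.not_nonempty_iff_eq_empty] at hne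
      rw [Set.inter_assoc, Set.inter_comm _ (Q j), hne]; simp
  · have hEl : ∀ x ∈ S'.set, ∀ x' y' y, R x' y' → dist x x' ≤ η → y ∈ T.set → dist y y' ≤ η →
        y ∈ E := fun x hx x' y' y hR h1 hy h2 => ⟨hy, x, hx, x', y', hR, h1, h2⟩
    exact
    { root := ⟨S'.root_mem, subset_closure hroot, _, _, h.root, by simpa using hη0.le,
        by simpa using hη0.le⟩
      mem := fun x y hxy => ⟨hxy.1, hxy.2.1⟩
      left := fun x hx => by
        obtain ⟨y, hy⟩ := h.left x (hle.1 hx)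
        exact ⟨y, hx, subset_closure (hEl x hx x y y hy (by simpa using hη0.le) (h.mem _ _ hy).2
          (by simpa using hη0.le)), x, y, hy, by simpa using hη0.le, by simpa using hη0.le⟩
      right := fun y hy => by
        obtain ⟨y1, ⟨hy1, x, hx, x', y', hR, h1, h2⟩, hd⟩ := Metric.mem_closure_iff.1 hy η hη0
        refine ⟨x, hx, hy, x', y', hR, h1, ?_⟩
        linarith [dist_triangle y y1 y']
      dist_le := by
        rintro x y x' y' ⟨hx, hy, a, b, hR, h1, h2⟩ ⟨hx', hy', a', b', hR', h1', h2'⟩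
        have e1 := abs_le.1 (h.dist_le _ _ _ _ hR hR')
        have t1 := dist_triangle4 x a a' x'
        have t2 := dist_triangle4 a x x' a'
        have t3 := dist_triangle4 y b b' y'
        have t4 := dist_triangle4 b y y' b'
        rw [dist_comm a' x'] at t1
        rw [dist_comm a x] at t2
        rw [dist_comm b' y'] at t3
        rw [dist_comm b y] at t4
        rw [abs_le]
        constructor <;> linarith
      meas_left := fun A => by
        let IA : Finset (Fin k) := Finset.univ.filter fun i => (P i ∩ S'.set ∩ A).Nonempty
        let N : Finset (Fin l) := Finset.univ.filter fun j => ∃ i ∈ IA, r i j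
        have hNsub : ∀ j ∈ N, Q j ⊆ closure E ∧ ∀ y ∈ Q j, ∃ x ∈ A, x ∈ S'.set ∧ y ∈ closure E ∧
            ∃ x' y', R x' y' ∧ dist x x' ≤ η ∧ dist y y' ≤ 2 * η := by
          intro j hj
          simp only [N, IA, Finset.mem_filter, Finset.mem_univ, true_and, r] at hj
          obtain ⟨i, ⟨a, ⟨haP, haS⟩, haA⟩, x', hx', y', hy', hR⟩ := hj
          have key : ∀ y ∈ Q j, y ∈ E := fun y hy =>
            hEl a haS x' y' y hR (hPη i _ haP _ hx') (hQU ▸ Set.mem_iUnion.2 ⟨j, hy⟩)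
              (hQη j _ hy _ hy')
          refine ⟨fun y hy => subset_closure (key y hy), fun y hy => ⟨a, haA, haS,
            subset_closure (key y hy), x', y', hR, hPη i _ haP _ hx', ?_⟩⟩
          linarith [hQη j _ hy _ hy']
        calc S'.meas A = S'.meas (A ∩ S'.set) := sub_meas_inter _ _
          _ ≤ S'.meas (⋃ i ∈ IA, P i) := by
            refine measure_mono ?_
            rintro x ⟨hxA, hx⟩
            have := hle.1 hx
            rw [← hPU] at this
            obtain ⟨i, hi⟩ := Set.mem_iUnion.1 this
            simp only [Set.mem_iUnion]
            exact ⟨i, by simpa [IA] using ⟨x, ⟨hi, hx⟩, hxA⟩, hi⟩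
          _ ≤ ∑ i ∈ IA, S'.meas (P i) := measure_biUnion_finset_le _ _
          _ = ENNReal.ofReal (∑ i ∈ IA, (S'.meas (P i)).toReal) := by
            rw [ENNReal.ofReal_sum_of_nonneg (fun _ _ => ENNReal.toReal_nonneg)]
            exact Finset.sum_congr rfl fun i _ => (ENNReal.ofReal_toReal (fS' _)).symm
          _ ≤ ENNReal.ofReal (∑ j ∈ N, c j * (T.meas (Q j)).toReal + δ') :=
            ENNReal.ofReal_le_ofReal ((hc1 IA).trans (by
              refine add_le_add (le_of_eq ?_) (by linarith)
              congr! ))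
          _ ≤ ∑ j ∈ N, ENNReal.ofReal (c j * (T.meas (Q j)).toReal) + ENNReal.ofReal δ' := by
            rw [← ENNReal.ofReal_sum_of_nonneg
              (fun j _ => mul_nonneg (c0 j) ENNReal.toReal_nonneg)]
            exact ENNReal.ofReal_add_le
          _ = T'.meas (⋃ j ∈ N, Q j) + ENNReal.ofReal δ' := by
            rw [measure_biUnion_finset (fun i _ j _ hij => hQd hij) (fun i _ => hQ i)]
            congr 1
            refine Finset.sum_congr rfl fun j hj => ?_
            change _ = (ν0.restrict (closure E)) _
            rw [Measure.restrict_apply (hQ j), Set.inter_eq_self_of_subset_left (hNsub j hj).1,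
              hν0Q]
          _ ≤ _ := by
            refine add_le_add_left (measure_mono ?_) _
            intro y hy
            simp only [Set.mem_iUnion] at hy
            obtain ⟨j, hj, hy⟩ := hy
            exact (hNsub j hj).2 y hy
      meas_right := fun A => by
        let JA : Finset (Fin l) := Finset.univ.filter fun j => (Q j ∩ closure E ∩ A).Nonempty
        let M : Finset (Fin k) := Finset.univ.filter fun i => ∃ j ∈ JA, r i j
        calc T'.meas A = T'.meas (A ∩ T'.set) := sub_meas_inter _ _
          _ ≤ T'.meas (⋃ j ∈ JA, Q j) := by
            refine measure_mono ?_
            rintro x ⟨hxA, hx⟩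
            have := hclT hx
            rw [← hQU] at this
            obtain ⟨i, hi⟩ := Set.mem_iUnion.1 this
            simp only [Set.mem_iUnion]
            refine ⟨i, ?_, hi⟩
            simp only [JA, Finset.mem_filter, Finset.mem_univ, true_and]
            exact ⟨x, ⟨hi, hx⟩, hxA⟩
          _ ≤ ∑ j ∈ JA, T'.meas (Q j) := measure_biUnion_finset_le _ _
          _ ≤ ∑ j ∈ JA, ENNReal.ofReal (c j * (T.meas (Q j)).toReal) :=
            Finset.sum_le_sum fun j _ => (Measure.restrict_le_self (μ := ν0) _).trans (hν0Q j).le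
          _ = ENNReal.ofReal (∑ j ∈ JA, c j * (T.meas (Q j)).toReal) :=
            (ENNReal.ofReal_sum_of_nonneg
              (fun j _ => mul_nonneg (c0 j) ENNReal.toReal_nonneg)).symm
          _ ≤ ENNReal.ofReal (∑ i ∈ M, (S'.meas (P i)).toReal + δ') :=
            ENNReal.ofReal_le_ofReal ((hc2 JA).trans (by
              refine add_le_add (le_of_eq ?_) (by linarith)
              congr! ))
          _ ≤ ∑ i ∈ M, S'.meas (P i) + ENNReal.ofReal δ' := by
            refine ENNReal.ofReal_add_le.trans (add_le_add_left (le_of_eq ?_) _)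
            rw [ENNReal.ofReal_sum_of_nonneg (fun _ _ => ENNReal.toReal_nonneg)]
            exact Finset.sum_congr rfl fun i _ => ENNReal.ofReal_toReal (fS' _)
          _ = S'.meas ((⋃ i ∈ M, P i) ∩ S'.set) + ENNReal.ofReal δ' := by
            rw [← sub_meas_inter,
              measure_biUnion_finset (fun i _ j _ hij => hPd hij) (fun i _ => hP i)]
          _ ≤ _ := by
            refine add_le_add_left (measure_mono ?_) _
            rintro x ⟨hx, hxS⟩
            simp only [Set.mem_iUnion] at hx
            obtain ⟨i, hi, hx⟩ := hx
            simp only [M, JA, Finset.mem_filter, Finset.mem_univ, true_and, r] at hi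
            obtain ⟨j, ⟨y, ⟨hyQ, hyE⟩, hyA⟩, x', hx', y', hy', hR⟩ := hi
            refine ⟨y, hyA, hxS, hyE, x', y', hR, hPη i _ hx _ hx', ?_⟩
            linarith [hQη j _ hyQ _ hy'] }

/-! ### Unpacking and packing `aEps`, the triangle inequality -/

theorem sub_le_trans {𝒳 : PMM} {S T U : SubPMM 𝒳} (h : S ≤ T) (h' : T ≤ U) : S ≤ U :=
  ⟨h.1.trans h'.1, h.2.trans h'.2⟩

theorem ballSub_compact {𝒳 : PMM} (h : 𝒳.BoundedlyCompact) (r : ℝ) :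
    (𝒳.ballSub r).IsCompactSub := by
  refine ⟨(h.1 _ r).insert _, ?_⟩
  rw [ballSub_meas, Measure.restrict_apply_univ]
  refine ne_top_of_le_ne_top (h.2 𝒳.basepoint (max r 0)) (measure_mono ?_)
  exact Set.insert_subset (by simp) (Metric.closedBall_subset_closedBall (le_max_left _ _))

theorem le_ballSub {𝒳 : PMM} {S : SubPMM 𝒳} {r : ℝ} (h : S.set ⊆ (𝒳.ballSub r).set) :
    S ≤ 𝒳.ballSub r := by
  refine ⟨h, Measure.le_iff.2 fun A hA => ?_⟩
  rw [sub_meas_inter, ballSub_meas, Measure.restrict_apply hA]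
  exact (measure_mono (Set.inter_subset_inter_right _ h)).trans (S.meas_le _)

theorem ballSub_mono {𝒳 : PMM} {r r' : ℝ} (h : r ≤ r') : 𝒳.ballSub r ≤ 𝒳.ballSub r' :=
  le_ballSub (Set.insert_subset_insert (Metric.closedBall_subset_closedBall h))

theorem aEps_unpack {𝒳 𝒴 : PMM} (hX : 𝒳.BoundedlyCompact) (hY : 𝒴.BoundedlyCompact) {ε : ℝ}
    (hε : 0 < ε) (h : aEps ε 𝒳 𝒴 < ε / 2) :
    ∃ (Y' : SubPMM 𝒴) (δ : ℝ) (R : 𝒳.carrier → 𝒴.carrier → Prop), Y'.IsCompactSub ∧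
      𝒴.ballSub (1 / ε - ε) ≤ Y' ∧ 0 < δ ∧ δ < ε / 2 ∧ IsRel (𝒳.ballSub (1 / ε)) Y' δ R := by
  obtain ⟨x, ⟨Y', hc, hb, rfl⟩, hx⟩ := exists_lt_of_csInf_lt
    (by exact ⟨_, 𝒴.ballSub (1 / ε - ε), ballSub_compact hY _, ballSub_mono le_rfl, rfl⟩) h
  obtain ⟨δ, hδ1, hδ2⟩ := exists_between hx
  obtain ⟨R, hR⟩ := exists_rel_of_cGHP_lt (ballSub_compact hX _) hc hδ1
  exact ⟨Y', δ, R, hc, hb, (cGHP_nonneg _ _).trans_lt hδ1, hδ2, hR⟩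

theorem aEps_pack {𝒳 𝒴 : PMM} (hX : 𝒳.BoundedlyCompact) {ε δ : ℝ} {Y' : SubPMM 𝒴}
    {R : 𝒳.carrier → 𝒴.carrier → Prop} (hc : Y'.IsCompactSub)
    (hb : 𝒴.ballSub (1 / ε - ε) ≤ Y') (h0 : 0 < δ) (hδ : δ < ε / 2)
    (hR : IsRel (𝒳.ballSub (1 / ε)) Y' δ R) : aEps ε 𝒳 𝒴 < ε / 2 := by
  refine lt_of_le_of_lt (csInf_le ⟨0, ?_⟩ ⟨Y', hc, hb, rfl⟩)
    ((hR.cGHP_le (ballSub_compact hX _) hc h0).trans_lt hδ)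
  rintro x ⟨Y'', -, -, rfl⟩
  exact cGHP_nonneg _ _

theorem aEps_chain {𝒳 𝒴 𝒵 : PMM} (hX : 𝒳.BoundedlyCompact) (hY : 𝒴.BoundedlyCompact)
    (hZ : 𝒵.BoundedlyCompact) {ε δ : ℝ} (hε : 0 < ε) (hδ : 0 < δ) (h1 : ε + δ ≤ 1)
    (h : aEps ε 𝒳 𝒴 < ε / 2) (h' : aEps δ 𝒴 𝒵 < δ / 2) :
    aEps (ε + δ) 𝒳 𝒵 < (ε + δ) / 2 := by
  obtain ⟨Y', ε₁, R, cY', bY', ε₁0, ε₁lt, hR⟩ := aEps_unpack hX hY hε h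
  obtain ⟨Z', δ₁, Q, cZ', bZ', δ₁0, δ₁lt, hQ⟩ := aEps_unpack hY hZ hδ h'
  obtain ⟨ε₂, e1, e2⟩ := exists_between ε₁lt
  obtain ⟨δ₂, d1, d2⟩ := exists_between δ₁lt
  obtain ⟨r, hr⟩ : ∃ r, r = 1 / (ε + δ) := ⟨_, rfl⟩
  have hr1 : 1 ≤ r := by rw [hr]; exact one_le_one_div (by linarith) h1
  have hrε : r ≤ 1 / ε := by rw [hr]; exact one_div_le_one_div_of_le hε (by linarith)
  have hrδ : r + ε ≤ 1 / δ := by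
    have hs : 0 < ε + δ := by linarith
    have : 1 / δ - r - ε = ε * (1 - δ * (ε + δ)) / (δ * (ε + δ)) := by
      rw [hr]; field_simp; ring
    have h3 : 0 ≤ ε * (1 - δ * (ε + δ)) / (δ * (ε + δ)) := by
      apply div_nonneg _ (by positivity)
      apply mul_nonneg hε.le
      nlinarith
    linarith
  obtain ⟨Y'', cY'', leY, bY'', R', hR'⟩ := restrict_rel (ballSub_compact hX _)
    (ballSub_compact hX r) cY' ε₁0.le e1 hR (ballSub_mono hrε) (ρ := r - ε) (ρ' := r)
    (by linarith) (by linarith) (ballSub_mono le_rfl)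
    (sub_le_trans (ballSub_mono (by linarith)) bY')
  have hsub : Y'' ≤ 𝒴.ballSub (1 / δ) := by
    refine le_ballSub fun y hy => ?_
    rw [mem_ballSub (by positivity)]
    obtain ⟨x, hx⟩ := hR'.right y hy
    have h2 := (hR'.mem _ _ hx).1
    rw [mem_ballSub (by linarith)] at h2
    have h3 := abs_le.1 (hR'.dist_le _ _ _ _ hx hR'.root)
    linarith [h3.1]
  obtain ⟨Z'', cZ'', leZ, bZ'', Q', hQ'⟩ := restrict_rel (ballSub_compact hY _)
    cY'' cZ' δ₁0.le d1 hQ hsub (ρ := r - ε - δ) (ρ' := r - ε)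
    (by linarith) (by linarith) bY''
    (sub_le_trans (ballSub_mono (by linarith)) bZ')
  have hcomp := IsRel.comp (by linarith) (by linarith) hR' hQ'
  rw [hr] at hcomp
  refine aEps_pack hX cZ'' ?_ (by linarith) (by linarith) hcomp
  rwa [← hr, ← sub_sub]

theorem GHP_bddBelow (𝒳 𝒴 : PMM) : BddBelow (insert (1 : ℝ) {ε : ℝ | ε ∈ Set.Ioc (0 : ℝ) 1 ∧
    max (aEps ε 𝒳 𝒴) (aEps ε 𝒴 𝒳) < ε / 2}) := by
  refine ⟨0, ?_⟩
  rintro x (rfl | hx)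
  · exact zero_le_one
  · exact hx.1.1.le

theorem GHP_nonneg (𝒳 𝒴 : PMM) : 0 ≤ GHP 𝒳 𝒴 := by
  refine le_csInf ⟨1, Set.mem_insert _ _⟩ ?_
  rintro x (rfl | hx)
  · exact zero_le_one
  · exact hx.1.1.le

theorem GHP_le_one (𝒳 𝒴 : PMM) : GHP 𝒳 𝒴 ≤ 1 :=
  csInf_le (GHP_bddBelow _ _) (Set.mem_insert _ _)

theorem GHP_le {𝒳 𝒴 : PMM} {ε : ℝ} (h0 : 0 < ε) (h1 : ε ≤ 1) (h : aEps ε 𝒳 𝒴 < ε / 2)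
    (h' : aEps ε 𝒴 𝒳 < ε / 2) : GHP 𝒳 𝒴 ≤ ε :=
  csInf_le (GHP_bddBelow _ _) (Set.mem_insert_of_mem _ ⟨⟨h0, h1⟩, max_lt h h'⟩)

theorem GHP_symm (𝒳 𝒴 : PMM) : GHP 𝒳 𝒴 = GHP 𝒴 𝒳 := by
  simp only [GHP, max_comm]

theorem GHP_triangle {𝒳 𝒴 𝒵 : PMM} (hX : 𝒳.BoundedlyCompact) (hY : 𝒴.BoundedlyCompact)
    (hZ : 𝒵.BoundedlyCompact) : GHP 𝒳 𝒵 ≤ GHP 𝒳 𝒴 + GHP 𝒴 𝒵 := by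
  have key : ∀ a ∈ insert (1 : ℝ) {ε : ℝ | ε ∈ Set.Ioc (0 : ℝ) 1 ∧
      max (aEps ε 𝒳 𝒴) (aEps ε 𝒴 𝒳) < ε / 2},
      ∀ b ∈ insert (1 : ℝ) {ε : ℝ | ε ∈ Set.Ioc (0 : ℝ) 1 ∧
      max (aEps ε 𝒴 𝒵) (aEps ε 𝒵 𝒴) < ε / 2}, GHP 𝒳 𝒵 ≤ a + b := by
    intro a ha b hb
    have ha0 : 0 < a := by
      rcases ha with rfl | ha
      · exact one_pos
      · exact ha.1.1
    have hb0 : 0 < b := by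
      rcases hb with rfl | hb
      · exact one_pos
      · exact hb.1.1
    rcases lt_or_ge 1 (a + b) with h1 | h1
    · exact (GHP_le_one _ _).trans h1.le
    rcases ha with rfl | ha
    · linarith
    rcases hb with rfl | hb
    · linarith
    refine GHP_le (by linarith) h1
      (aEps_chain hX hY hZ ha0 hb0 h1 (max_lt_iff.1 ha.2).1 (max_lt_iff.1 hb.2).1) ?_
    have := aEps_chain hZ hY hX hb0 ha0 (by linarith) (max_lt_iff.1 hb.2).2 (max_lt_iff.1 ha.2).2
    rwa [add_comm b a] at this
  have h1 : ∀ b ∈ insert (1 : ℝ) {ε : ℝ | ε ∈ Set.Ioc (0 : ℝ) 1 ∧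
      max (aEps ε 𝒴 𝒵) (aEps ε 𝒵 𝒴) < ε / 2}, GHP 𝒳 𝒵 - b ≤ GHP 𝒳 𝒴 := fun b hb =>
    le_csInf ⟨1, Set.mem_insert _ _⟩ fun a ha => by linarith [key a ha b hb]
  have h2 : GHP 𝒳 𝒵 - GHP 𝒳 𝒴 ≤ GHP 𝒴 𝒵 :=
    le_csInf ⟨1, Set.mem_insert _ _⟩ fun b hb => by linarith [h1 b hb]
  linarith

/-! ### Isometric spaces are at distance zero -/

theorem GHPIsometric.symm' {𝒳 𝒴 : PMM} (h : GHPIsometric 𝒳 𝒴) : GHPIsometric 𝒴 𝒳 := by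
  obtain ⟨f, hf, hs, ho, hm⟩ := h
  let e : 𝒳.carrier ≃ᵢ 𝒴.carrier := ⟨Equiv.ofBijective f ⟨hf.injective, hs⟩, hf⟩
  have he : ∀ x, e.symm (f x) = x := fun x => e.symm_apply_apply x
  refine ⟨e.symm, e.symm.isometry, e.symm.surjective, ?_, ?_⟩
  · rw [← ho, he]
  · rw [← hm, Measure.map_map e.symm.continuous.measurable hf.continuous.measurable]
    have : (e.symm ∘ f) = id := funext he
    rw [this, Measure.map_id]

theorem GHPIsometric.boundedlyCompact {𝒳 𝒴 : PMM} (h : GHPIsometric 𝒳 𝒴)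
    (hX : 𝒳.BoundedlyCompact) : 𝒴.BoundedlyCompact := by
  obtain ⟨f, hf, hs, ho, hm⟩ := h
  refine ⟨fun y r => ?_, fun y r => ?_⟩
  · obtain ⟨x, rfl⟩ := hs y
    have : Metric.closedBall (f x) r = f '' Metric.closedBall x r := by
      rw [← hf.preimage_closedBall, Set.image_preimage_eq _ hs]
    rw [this]
    exact (hX.1 x r).image hf.continuous
  · obtain ⟨x, rfl⟩ := hs y
    rw [← hm, Measure.map_apply hf.continuous.measurable measurableSet_closedBall,
      hf.preimage_closedBall]
    exact hX.2 x r

theorem aEps_lt_of_isometric {𝒳 𝒴 : PMM} (hX : 𝒳.BoundedlyCompact) (h : GHPIsometric 𝒳 𝒴)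
    {ε : ℝ} (h0 : 0 < ε) : aEps ε 𝒳 𝒴 < ε / 2 := by
  have hY := h.boundedlyCompact hX
  obtain ⟨f, hf, hs, ho, hm⟩ := h
  have hmf := hf.continuous.measurable
  have hset : f ⁻¹' (𝒴.ballSub (1 / ε)).set = (𝒳.ballSub (1 / ε)).set := by
    ext x
    rw [Set.mem_preimage, mem_ballSub (by positivity), mem_ballSub (by positivity), ← ho,
      hf.dist_eq]
  have hmem : ∀ x, f x ∈ (𝒴.ballSub (1 / ε)).set ↔ x ∈ (𝒳.ballSub (1 / ε)).set := fun x => by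
    rw [← hset]; rfl
  let e : 𝒳.carrier ≃ᵢ 𝒴.carrier := ⟨Equiv.ofBijective f ⟨hf.injective, hs⟩, hf⟩
  have hme : ∀ A, 𝒴.meas A = 𝒳.meas (f ⁻¹' A) := fun A => by
    rw [← hm]
    exact e.toHomeomorph.toMeasurableEquiv.map_apply A
  have hmeas : ∀ A, (𝒴.ballSub (1 / ε)).meas A = (𝒳.ballSub (1 / ε)).meas (f ⁻¹' A) := fun A => by
    rw [ballSub_meas, ballSub_meas, Measure.restrict_apply' (measurableSet_ballSub _),
      Measure.restrict_apply' (measurableSet_ballSub _), hme, Set.preimage_inter, hset]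
  refine aEps_pack (δ := ε / 4) (R := fun x y => x ∈ (𝒳.ballSub (1 / ε)).set ∧ y = f x) hX
    (ballSub_compact hY (1 / ε)) (ballSub_mono (by linarith)) (by linarith) (by linarith) ?_
  exact
  { root := ⟨(𝒳.ballSub (1 / ε)).root_mem, ho.symm⟩
    mem := by
      rintro x y ⟨hx, rfl⟩
      exact ⟨hx, (hmem x).2 hx⟩
    left := fun x hx => ⟨f x, hx, rfl⟩
    right := fun y hy => by
      obtain ⟨x, rfl⟩ := hs y
      exact ⟨x, (hmem x).1 hy, rfl⟩
    dist_le := by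
      rintro x y x' y' ⟨-, rfl⟩ ⟨-, rfl⟩
      rw [hf.dist_eq, sub_self, abs_zero]
      linarith
    meas_left := fun A => by
      refine le_trans ?_ le_self_add
      rw [sub_meas_inter, hmeas]
      exact measure_mono fun x hx => ⟨x, hx.1, hx.2, rfl⟩
    meas_right := fun A => by
      refine le_trans ?_ le_self_add
      rw [sub_meas_inter, hmeas]
      exact measure_mono fun x hx => ⟨f x, hx.1, (hmem x).1 hx.2, rfl⟩ }

theorem GHP_eq_zero_of_isometric {𝒳 𝒴 : PMM} (hX : 𝒳.BoundedlyCompact)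
    (h : GHPIsometric 𝒳 𝒴) : GHP 𝒳 𝒴 = 0 := by
  have hY := h.boundedlyCompact hX
  refine le_antisymm (le_of_forall_pos_le_add fun ε hε => ?_) (GHP_nonneg _ _)
  have h0 : 0 < min ε 1 := lt_min hε one_pos
  have := GHP_le h0 (min_le_right _ _) (aEps_lt_of_isometric hX h h0)
    (aEps_lt_of_isometric hY h.symm' h0)
  linarith [min_le_left ε 1]

theorem GHP_congr {𝒳 𝒳' 𝒴 𝒴' : PMM} (hX : 𝒳.BoundedlyCompact) (hY : 𝒴.BoundedlyCompact)
    (h : GHPIsometric 𝒳 𝒳') (h' : GHPIsometric 𝒴 𝒴') : GHP 𝒳 𝒴 = GHP 𝒳' 𝒴' := by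
  have hX' := h.boundedlyCompact hX
  have hY' := h'.boundedlyCompact hY
  have e1 := GHP_eq_zero_of_isometric hX h
  have e2 := GHP_eq_zero_of_isometric hY h'
  have e3 := GHP_symm 𝒳 𝒳'
  have e4 := GHP_symm 𝒴 𝒴'
  linarith [GHP_triangle hX hX' hY, GHP_triangle hX' hY' hY, GHP_triangle hX' hX hY',
    GHP_triangle hX hY hY']

/-! ### Spaces at distance zero are isometric -/

theorem IsRel.mono {𝒳 𝒴 : PMM} {S : SubPMM 𝒳} {T : SubPMM 𝒴} {δ δ' : ℝ}
    {R : 𝒳.carrier → 𝒴.carrier → Prop} (h : IsRel S T δ R) (hδ : δ ≤ δ') : IsRel S T δ' R where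
  root := h.root
  mem := h.mem
  left := h.left
  right := h.right
  dist_le := fun x y x' y' h1 h2 => (h.dist_le x y x' y' h1 h2).trans (by linarith)
  meas_left := fun A => (h.meas_left A).trans (add_le_add le_rfl (ENNReal.ofReal_le_ofReal hδ))
  meas_right := fun A => (h.meas_right A).trans (add_le_add le_rfl (ENNReal.ofReal_le_ofReal hδ))

theorem exists_rels {𝒳 𝒴 : PMM} (hX : 𝒳.BoundedlyCompact) (hY : 𝒴.BoundedlyCompact)
    (h : GHP 𝒳 𝒴 = 0) (n : ℕ) : ∃ (S : SubPMM 𝒳) (T : SubPMM 𝒴)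
      (R : 𝒳.carrier → 𝒴.carrier → Prop), 𝒳.ballSub n ≤ S ∧ 𝒴.ballSub n ≤ T ∧
        IsRel S T (1 / ((n : ℝ) + 1)) R := by
  have hn : (0 : ℝ) < 1 / ((n : ℝ) + 1) := by positivity
  have hn1 : 1 / ((n : ℝ) + 1) ≤ 1 := by
    rw [div_le_one (by positivity)]
    linarith [(Nat.cast_nonneg n : (0 : ℝ) ≤ n)]
  have h' : GHP 𝒳 𝒴 < 1 / ((n : ℝ) + 1) := by rw [h]; exact hn
  obtain ⟨ε, hε, hlt⟩ := exists_lt_of_csInf_lt (by exact ⟨1, Set.mem_insert _ _⟩) h'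
  rcases hε with rfl | hε
  · linarith
  have h0 := hε.1.1
  obtain ⟨Y', δ, R, -, hb, δ0, δlt, hR⟩ := aEps_unpack hX hY h0 (max_lt_iff.1 hε.2).1
  have hinv : (n : ℝ) + 1 ≤ 1 / ε := by
    rw [le_div_iff₀ h0]
    rw [lt_div_iff₀ (by positivity)] at hlt
    linarith
  exact ⟨_, Y', R, ballSub_mono (by linarith), sub_le_trans (ballSub_mono (by linarith)) hb,
    hR.mono (by linarith)⟩

theorem meas_le_of_cthickening {𝒴 : PMM} (hY : 𝒴.BoundedlyCompact) {K : Set 𝒴.carrier}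
    (hK : IsCompact K) {a : ENNReal}
    (h : ∀ δ : ℝ, 0 < δ → a ≤ 𝒴.meas (Metric.cthickening δ K) + ENNReal.ofReal δ) :
    a ≤ 𝒴.meas K := by
  have h1 : Tendsto (fun r => 𝒴.meas (Metric.cthickening r K)) (𝓝 0) (𝓝 (𝒴.meas K)) := by
    refine tendsto_measure_cthickening_of_isClosed ⟨1, one_pos, ?_⟩ hK.isClosed
    obtain ⟨r, hr⟩ := (hK.isBounded.cthickening (δ := 1)).subset_closedBall 𝒴.basepoint
    exact ne_top_of_le_ne_top (hY.2 _ r) (measure_mono hr)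
  have h2 : Tendsto (fun r : ℝ => ENNReal.ofReal r) (𝓝 0) (𝓝 0) := by
    simpa using ENNReal.tendsto_ofReal (tendsto_id (α := ℝ) (x := 𝓝 0))
  have h3 := (h1.add h2).mono_left (nhdsWithin_le_nhds (s := Set.Ioi (0 : ℝ)))
  rw [add_zero] at h3
  refine ge_of_tendsto h3 ?_
  filter_upwards [self_mem_nhdsWithin] with r hr
  exact h r hr

theorem meas_le_sub {𝒳 : PMM} {S : SubPMM 𝒳} {n : ℝ} (hn : 0 ≤ n) (hS : 𝒳.ballSub n ≤ S)
    {K : Set 𝒳.carrier} (hK : ∀ x ∈ K, dist x 𝒳.basepoint ≤ n) : 𝒳.meas K ≤ S.meas K := by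
  refine le_trans (le_of_eq ?_) (hS.2 K)
  rw [ballSub_meas, Measure.restrict_apply' (measurableSet_ballSub _),
    Set.inter_eq_self_of_subset_left]
  intro x hx
  rw [mem_ballSub hn]
  exact hK x hx

theorem ext_of_compact {𝒴 : PMM} (hY : 𝒴.BoundedlyCompact) (μ : Measure 𝒴.carrier)
    (h : ∀ K, IsCompact K → 𝒴.meas K = μ K) : 𝒴.meas = μ := by
  have hU : ⋃ n : ℕ, Metric.closedBall 𝒴.basepoint (n : ℝ) = Set.univ :=
    Metric.iUnion_closedBall_nat _
  refine Measure.ext_of_generateFrom_of_iUnion {K | IsCompact K}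
    (fun n : ℕ => Metric.closedBall 𝒴.basepoint (n : ℝ)) ?_ ?_ hU (fun n => hY.1 _ _)
    (fun n => hY.2 _ _) h
  · refine le_antisymm ?_ ?_
    · change borel _ ≤ _
      rw [borel_eq_generateFrom_isClosed]
      refine MeasurableSpace.generateFrom_le fun s hs => ?_
      have : s = ⋃ n : ℕ, s ∩ Metric.closedBall 𝒴.basepoint (n : ℝ) := by
        rw [← Set.inter_iUnion, hU, Set.inter_univ]
      rw [this]
      exact MeasurableSet.iUnion fun n =>
        MeasurableSpace.measurableSet_generateFrom ((hY.1 _ _).inter_left hs)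
    · exact MeasurableSpace.generateFrom_le fun s hs => IsCompact.measurableSet hs
  · intro s hs t ht _
    exact IsCompact.inter hs ht

theorem isometric_of_GHP_eq_zero {𝒳 𝒴 : PMM} (hX : 𝒳.BoundedlyCompact)
    (hY : 𝒴.BoundedlyCompact) (h : GHP 𝒳 𝒴 = 0) : GHPIsometric 𝒳 𝒴 := by
  choose S T R hS hT hR using exists_rels hX hY h
  have hsmall : ∀ n : ℕ, 1 / ((n : ℝ) + 1) ≤ 1 := fun n => by
    rw [div_le_one (by positivity)]
    linarith [(Nat.cast_nonneg n : (0 : ℝ) ≤ n)]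
  have hdist : ∀ n x y, R n x y →
      |dist x 𝒳.basepoint - dist y 𝒴.basepoint| ≤ 2 * (1 / ((n : ℝ) + 1)) := fun n x y hxy =>
    (hR n).dist_le _ _ _ _ hxy (hR n).root
  have hg : ∀ (n : ℕ) (x : 𝒳.carrier), ∃ y, (dist x 𝒳.basepoint ≤ n → R n x y) ∧
      dist y 𝒴.basepoint ≤ dist x 𝒳.basepoint + 2 := by
    intro n x
    by_cases hx : dist x 𝒳.basepoint ≤ n
    · obtain ⟨y, hy⟩ := (hR n).left x ((hS n).1 ((mem_ballSub (Nat.cast_nonneg n) x).2 hx))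
      refine ⟨y, fun _ => hy, ?_⟩
      linarith [(abs_le.1 (hdist n x y hy)).1, hsmall n]
    · refine ⟨𝒴.basepoint, fun h => absurd h hx, ?_⟩
      rw [dist_self]
      positivity
  choose g hgR hgd using hg
  have hlim : ∀ x, ∃ y, Tendsto (fun n => g n x) (hyperfilter ℕ : Filter ℕ) (𝓝 y) := by
    intro x
    obtain ⟨y, -, hy⟩ := (hY.1 𝒴.basepoint (dist x 𝒳.basepoint + 2)).ultrafilter_le_nhds
      ((hyperfilter ℕ).map (fun n => g n x)) (by
        rw [Ultrafilter.coe_map, le_principal_iff, mem_map]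
        exact Filter.univ_mem' fun n => hgd n x)
    exact ⟨y, hy⟩
  choose f hf using hlim
  have hF : (hyperfilter ℕ : Filter ℕ) ≤ atTop := Nat.hyperfilter_le_atTop
  have hbig : ∀ r : ℝ, ∀ᶠ n : ℕ in (hyperfilter ℕ : Filter ℕ), r ≤ n := fun r =>
    hF (tendsto_natCast_atTop_atTop.eventually_ge_atTop r)
  have hδt : Tendsto (fun n : ℕ => 2 * (1 / ((n : ℝ) + 1))) (hyperfilter ℕ : Filter ℕ) (𝓝 0) := by
    have := (tendsto_one_div_add_atTop_nhds_zero_nat (𝕜 := ℝ)).const_mul 2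
    rw [mul_zero] at this
    exact this.mono_left hF
  have hδs : ∀ δ : ℝ, 0 < δ → ∀ᶠ n : ℕ in (hyperfilter ℕ : Filter ℕ),
      2 * (1 / ((n : ℝ) + 1)) < δ := fun δ hδ => hδt.eventually_lt_const hδ
  have hiso : Isometry f := by
    refine Isometry.of_dist_eq fun x x' => ?_
    refine tendsto_nhds_unique ((hf x).dist (hf x')) ?_
    rw [tendsto_iff_dist_tendsto_zero]
    refine squeeze_zero' (Eventually.of_forall fun _ => dist_nonneg) ?_ hδt
    filter_upwards [hbig (dist x 𝒳.basepoint), hbig (dist x' 𝒳.basepoint)] with n h1 h2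
    rw [Real.dist_eq, abs_sub_comm]
    exact (hR n).dist_le _ _ _ _ (hgR n x h1) (hgR n x' h2)
  have key : ∀ r δ : ℝ, 0 < δ → ∀ᶠ n : ℕ in (hyperfilter ℕ : Filter ℕ),
      ∀ x, dist x 𝒳.basepoint ≤ r → ∀ y, R n x y → dist y (f x) ≤ δ := by
    intro r δ hδ
    obtain ⟨t, -, tfin, ht⟩ := (hX.1 𝒳.basepoint r).finite_cover_balls
      (show (0 : ℝ) < δ / 4 by linarith)
    have h1 : ∀ᶠ n : ℕ in (hyperfilter ℕ : Filter ℕ), ∀ p ∈ t,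
        dist (g n p) (f p) < δ / 4 ∧ R n p (g n p) := by
      rw [eventually_all_finite tfin]
      intro p _
      filter_upwards [hbig (dist p 𝒳.basepoint),
        (Metric.tendsto_nhds.1 (hf p)) (δ / 4) (by linarith)] with n h1 h2
      exact ⟨h2, hgR n p h1⟩
    filter_upwards [h1, hδs (δ / 4) (by linarith)] with n h1 h2 x hx y hxy
    have hx' := ht (Metric.mem_closedBall.2 hx)
    simp only [Set.mem_iUnion, Metric.mem_ball, exists_prop] at hx'
    obtain ⟨p, hp, hxp⟩ := hx'
    obtain ⟨h3, h4⟩ := h1 p hp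
    have h5 := (abs_le.1 ((hR n).dist_le _ _ _ _ hxy h4)).1
    have h6 := hiso.dist_eq p x
    rw [dist_comm p x] at h6
    linarith [dist_triangle4 y (g n p) (f p) (f x)]
  have hroot : f 𝒳.basepoint = 𝒴.basepoint := by
    refine (dist_le_zero.1 (le_of_forall_pos_le_add fun δ hδ => ?_)).symm
    obtain ⟨n, hn⟩ := (key 0 δ hδ).exists
    rw [zero_add]
    exact hn _ (by simp) _ (hR n).root
  have hsurj : Function.Surjective f := by
    intro y
    have hc := ((hX.1 𝒳.basepoint (dist y 𝒴.basepoint + 2)).image hiso.continuous).isClosed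
    have : y ∈ f '' Metric.closedBall 𝒳.basepoint (dist y 𝒴.basepoint + 2) := by
      rw [← hc.closure_eq, Metric.mem_closure_iff]
      intro δ hδ
      obtain ⟨n, h1, h2⟩ := ((key (dist y 𝒴.basepoint + 2) (δ / 2) (by linarith)).and
        (hbig (dist y 𝒴.basepoint))).exists
      obtain ⟨x, hx⟩ := (hR n).right y ((hT n).1 ((mem_ballSub (Nat.cast_nonneg n) y).2 h2))
      have h3 : dist x 𝒳.basepoint ≤ dist y 𝒴.basepoint + 2 := by
        linarith [(abs_le.1 (hdist n x y hx)).2, hsmall n]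
      exact ⟨f x, ⟨x, h3, rfl⟩, by linarith [h1 x h3 y hx]⟩
    obtain ⟨x, -, hx⟩ := this
    exact ⟨x, hx⟩
  have hcomp : ∀ K, IsCompact K → 𝒳.meas K = 𝒴.meas (f '' K) := by
    intro K hK
    obtain ⟨r, hr⟩ := hK.isBounded.subset_closedBall 𝒳.basepoint
    have hr' : ∀ x ∈ K, dist x 𝒳.basepoint ≤ r := fun x hx => hr hx
    refine le_antisymm (meas_le_of_cthickening hY (hK.image hiso.continuous) fun δ hδ => ?_)
      (meas_le_of_cthickening hX hK fun δ hδ => ?_)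
    · obtain ⟨n, h1, h2, h3⟩ := ((key r δ hδ).and ((hbig r).and (hδs δ hδ))).exists
      have hle : 1 / ((n : ℝ) + 1) ≤ δ := by
        have : (0 : ℝ) < 1 / ((n : ℝ) + 1) := by positivity
        linarith
      refine (meas_le_sub (Nat.cast_nonneg n) (hS n) fun x hx => (hr' x hx).trans h2).trans
        (((hR n).meas_left K).trans (add_le_add (((T n).meas_le _).trans (measure_mono ?_))
          (ENNReal.ofReal_le_ofReal hle)))
      rintro y ⟨x, hx, hxy⟩
      exact Metric.mem_cthickening_of_dist_le y (f x) δ _ ⟨x, hx, rfl⟩ (h1 x (hr' x hx) y hxy)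
    · obtain ⟨n, h1, h2, h3⟩ := ((key (r + 2) δ hδ).and ((hbig r).and (hδs δ hδ))).exists
      have hle : 1 / ((n : ℝ) + 1) ≤ δ := by
        have : (0 : ℝ) < 1 / ((n : ℝ) + 1) := by positivity
        linarith
      have hrf : ∀ x ∈ K, dist (f x) 𝒴.basepoint ≤ r := fun x hx => by
        rw [← hroot, hiso.dist_eq]
        exact hr' x hx
      refine (meas_le_sub (Nat.cast_nonneg n) (hT n) ?_).trans
        (((hR n).meas_right (f '' K)).trans (add_le_add (((S n).meas_le _).trans
          (measure_mono ?_)) (ENNReal.ofReal_le_ofReal hle)))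
      · rintro _ ⟨x, hx, rfl⟩
        exact (hrf x hx).trans h2
      · rintro x' ⟨_, ⟨x, hx, rfl⟩, hxy⟩
        refine Metric.mem_cthickening_of_dist_le x' x δ _ hx ?_
        have h4 : dist x' 𝒳.basepoint ≤ r + 2 := by
          linarith [(abs_le.1 (hdist n _ _ hxy)).2, hsmall n, hrf x hx]
        have h5 := h1 x' h4 _ hxy
        rwa [hiso.dist_eq, dist_comm] at h5
  refine ⟨f, hiso, hsurj, hroot, (ext_of_compact hY _ fun L hL => ?_).symm⟩
  rw [Measure.map_apply hiso.continuous.measurable hL.measurableSet]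
  have hpre : IsCompact (f ⁻¹' L) := by
    refine hiso.isEmbedding.isInducing.isCompact_preimage ?_ hL
    rw [hsurj.range_eq]
    exact isClosed_univ
  rw [hcomp _ hpre, Set.image_preimage_eq _ hsurj]

/-- The Gromov-Hausdorff-Prokhorov distance induces a metric on the set of GHP-isometry
classes of boundedly compact pmm spaces: it depends only on GHP-isometry classes, is
symmetric, satisfies the triangle inequality, and vanishes exactly on pairs of GHP-isometric
spaces. -/
theorem GHP_is_metric :
    (∀ 𝒳 𝒳' 𝒴 𝒴' : PMM, 𝒳.BoundedlyCompact → 𝒴.BoundedlyCompact →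
      GHPIsometric 𝒳 𝒳' → GHPIsometric 𝒴 𝒴' → GHP 𝒳 𝒴 = GHP 𝒳' 𝒴') ∧
    (∀ 𝒳 𝒴 : PMM, GHP 𝒳 𝒴 = GHP 𝒴 𝒳) ∧
    (∀ 𝒳 𝒴 𝒵 : PMM, 𝒳.BoundedlyCompact → 𝒴.BoundedlyCompact → 𝒵.BoundedlyCompact →
      GHP 𝒳 𝒵 ≤ GHP 𝒳 𝒴 + GHP 𝒴 𝒵) ∧
    (∀ 𝒳 𝒴 : PMM, 𝒳.BoundedlyCompact → 𝒴.BoundedlyCompact →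
      (GHP 𝒳 𝒴 = 0 ↔ GHPIsometric 𝒳 𝒴)) := by
  exact ⟨fun _ _ _ _ hX hY h h' => GHP_congr hX hY h h', GHP_symm,
    fun _ _ _ hX hY hZ => GHP_triangle hX hY hZ,
    fun _ _ hX hY => ⟨isometric_of_GHP_eq_zero hX hY, GHP_eq_zero_of_isometric hX⟩⟩

end
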